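/- arXiv:2411.17494 — 3 statements merged into one kernel-verified Lean document; each statement's English description precedes it below -/
import Mathlib

section
/- Let d ≥ 5 and let f ∈ K[s,t] be a nonzero homogeneous polynomial of degree d such that no nonzero homogeneous polynomial of degree 2 annihilates f (G∘f = 0 ⟹ G = 0 for G homogeneous of degree 2), but some nonzero homogeneous polynomial of degree 3 annihilates f (i.e., the corresponding point p ∈ P^d has C_d-rank exactly 3). Then for every K-basis h₁,…,h_d of W_f, the ideal of K[z₁,…,z_d] generated by the degree-2 component (ker φ_h)₂ is generated by homogeneous quadratic polynomials of rank at most 4 contained in it. (In other words, for the projected curve C = π_p(C_d) with trisecant line L, the scheme X = C ∪ L cut out by the quadrics through C has rank index at most 4.) -/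
open MvPolynomial

/-- The apolarity action `G ∘ f = G(∂/∂s, ∂/∂t) f` for bivariate polynomials. -/
noncomputable def apolar {K : Type*} [CommSemiring K] (G f : MvPolynomial (Fin 2) K) :
    MvPolynomial (Fin 2) K :=
  ∑ a ∈ G.support, G.coeff a • ((⇑(pderiv (0 : Fin 2)))^[a 0] ((⇑(pderiv (1 : Fin 2)))^[a 1] f))

/-- A polynomial `q` has rank at most `k` as a quadric: it is a sum of `k` squares of
linear forms. -/
def rankLE {K : Type*} [CommSemiring K] {σ : Type*} (k : ℕ) (q : MvPolynomial σ K) : Prop :=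
  ∃ ℓ : Fin k → MvPolynomial σ K, (∀ i, (ℓ i).IsHomogeneous 1) ∧ q = ∑ i, (ℓ i) ^ 2

open Polynomial in
/-- bilinear factorisation -/
lemma bil_factor {K M : Type*} [Field K] [AddCommGroup M] [Module K M] (m n : ℕ)
    (B : K[X] →ₗ[K] K[X] →ₗ[K] M)
    (hB : ∀ i j i' j', i ≤ m → j ≤ n → i' ≤ m → j' ≤ n → i + j = i' + j' →
      B (Polynomial.X ^ i) (Polynomial.X ^ j) = B (Polynomial.X ^ i') (Polynomial.X ^ j')) :
    ∃ φ : K[X] →ₗ[K] M, ∀ u v : K[X], u.natDegree ≤ m → v.natDegree ≤ n →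
      B u v = φ (u * v) := by
  refine ⟨(Polynomial.basisMonomials K).constr K
    (fun k => B (Polynomial.X ^ (min k m)) (Polynomial.X ^ (k - min k m))), ?_⟩
  intro u v hu hv
  have key : ∀ k, ((Polynomial.basisMonomials K).constr K
    (fun k => B (Polynomial.X ^ (min k m)) (Polynomial.X ^ (k - min k m)))) (Polynomial.X ^ k)
      = B (Polynomial.X ^ (min k m)) (Polynomial.X ^ (k - min k m)) := by
    intro k
    have := (Polynomial.basisMonomials K).constr_basis K
      (fun k => B (Polynomial.X ^ (min k m)) (Polynomial.X ^ (k - min k m))) k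
    rw [Polynomial.coe_basisMonomials] at this
    rwa [← Polynomial.monomial_one_right_eq_X_pow]
  generalize ((Polynomial.basisMonomials K).constr K
    (fun k => B (Polynomial.X ^ (min k m)) (Polynomial.X ^ (k - min k m)))) = φ at key
  rw [Polynomial.as_sum_range_C_mul_X_pow' u (Nat.lt_succ_of_le hu),
    Polynomial.as_sum_range_C_mul_X_pow' v (Nat.lt_succ_of_le hv)]
  simp only [Polynomial.C_mul', map_sum, map_smul, LinearMap.sum_apply, LinearMap.smul_apply,
    Finset.sum_mul, Finset.mul_sum, smul_mul_assoc, mul_smul_comm, ← pow_add, Finset.smul_sum]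
  refine Finset.sum_congr rfl fun j hj => Finset.sum_congr rfl fun i hi => ?_
  simp only [Finset.mem_range] at hi hj
  rw [key, hB i j (min (i+j) m) (i + j - min (i+j) m)] <;> omega

lemma rank4_of {K : Type*} [Field K] [IsAlgClosed K] [CharZero K] {σ : Type*}
    (a b c e : MvPolynomial σ K) (ha : a.IsHomogeneous 1) (hb : b.IsHomogeneous 1)
    (hc : c.IsHomogeneous 1) (he : e.IsHomogeneous 1) : rankLE 4 (a * b - c * e) := by
  obtain ⟨i, hi⟩ := IsAlgClosed.exists_pow_nat_eq (-1 : K) (n := 2) (by norm_num)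
  have h2 : (C (2⁻¹ : K) : MvPolynomial σ K) * 2 = 1 := by
    rw [show (2 : MvPolynomial σ K) = C 2 from (map_ofNat C 2).symm, ← C_mul]; simp
  have hi2 : (C i : MvPolynomial σ K) ^ 2 = -1 := by rw [← C_pow, hi]; simp
  have hC : ∀ (r : K) (p : MvPolynomial σ K), p.IsHomogeneous 1 → (C r * p).IsHomogeneous 1 := by
    intro r p hp
    simpa using (isHomogeneous_C σ r).mul hp
  refine ⟨![C 2⁻¹ * (a + b), C i * (C 2⁻¹ * (a - b)), C i * (C 2⁻¹ * (c + e)), C 2⁻¹ * (c - e)],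
    ?_, ?_⟩
  · intro k
    fin_cases k
    · exact hC _ _ (ha.add hb)
    · exact hC _ _ (hC _ _ (ha.sub hb))
    · exact hC _ _ (hC _ _ (hc.add he))
    · exact hC _ _ (hc.sub he)
  · simp only [Fin.sum_univ_four, Matrix.cons_val]
    linear_combination (-(a*b - c * e)*(C (2⁻¹ : K)*2 + 1)) * h2 -
      ((C (2⁻¹ : K))^2*(a-b)^2 + (C (2⁻¹ : K))^2*(c+e)^2) * hi2

lemma coeff_pd {K : Type*} [Field K] (f : MvPolynomial (Fin 2) K) (i : Fin 2) (b : Fin 2 →₀ ℕ) :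
    (pderiv i f).coeff b = f.coeff (b + Finsupp.single i 1) * (b i + 1) := by
  classical
  induction f using MvPolynomial.induction_on' with
  | monomial a c =>
    rw [pderiv_monomial, coeff_monomial, coeff_monomial]
    by_cases h : a = b + Finsupp.single i 1
    · subst h; simp
    · rw [if_neg h]
      split_ifs with h2
      · have : a i = 0 := by
          by_contra h0
          apply h
          rw [← h2, tsub_add_cancel_of_le]
          simpa [Nat.one_le_iff_ne_zero] using h0
        simp [this]
      · simp
  | add p q hp hq => simp [hp, hq]; ring

lemma coeff_pd_iter {K : Type*} [Field K] (f : MvPolynomial (Fin 2) K) (i : Fin 2) (n : ℕ) :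
    ∀ (b : Fin 2 →₀ ℕ),
    ((⇑(pderiv i))^[n] f).coeff b * ((b i).factorial : K)
      = f.coeff (b + Finsupp.single i n) * ((b i + n).factorial : K) := by
  induction n with
  | zero => intro b; simp
  | succ n ih =>
    intro b
    rw [Function.iterate_succ_apply', coeff_pd]
    have := ih (b + Finsupp.single i 1)
    simp only [Finsupp.add_apply, Finsupp.single_eq_same, Nat.factorial_succ] at this
    rw [add_assoc, ← Finsupp.single_add] at this
    push_cast at this
    rw [mul_assoc, this]
    congr 2
    · rw [add_comm 1 n]
    · congr 1; omega

/-- The functional. -/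
noncomputable def Lam {K : Type*} [Field K] (f : MvPolynomial (Fin 2) K) :
    MvPolynomial (Fin 2) K →ₗ[K] K :=
  (MvPolynomial.basisMonomials (Fin 2) K).constr K
    (fun a => f.coeff a * ((a 0).factorial * (a 1).factorial : K))

lemma Lam_monomial {K : Type*} [Field K] (f : MvPolynomial (Fin 2) K) (a : Fin 2 →₀ ℕ) (c : K) :
    Lam f (monomial a c) = c * (f.coeff a * ((a 0).factorial * (a 1).factorial : K)) := by
  have := (MvPolynomial.basisMonomials (Fin 2) K).constr_basis K
      (fun a => f.coeff a * ((a 0).factorial * (a 1).factorial : K)) a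
  rw [MvPolynomial.coe_basisMonomials] at this
  have h2 : monomial a c = c • (monomial a 1 : MvPolynomial (Fin 2) K) := by
    rw [smul_monomial]; simp
  rw [h2, map_smul, smul_eq_mul]
  congr 1

lemma apolar_coeff {K : Type*} [Field K] (G f : MvPolynomial (Fin 2) K) (b : Fin 2 →₀ ℕ) :
    (apolar G f).coeff b * ((b 0).factorial * (b 1).factorial : K)
      = Lam f (G * monomial b 1) := by
  conv_rhs => rw [G.as_sum]
  rw [apolar, coeff_sum, Finset.sum_mul, Finset.sum_mul, map_sum]
  refine Finset.sum_congr rfl fun a _ => ?_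
  rw [monomial_mul, Lam_monomial, coeff_smul, smul_eq_mul, mul_one, mul_assoc]
  congr 1
  have h0 := coeff_pd_iter ((⇑(pderiv (1 : Fin 2)))^[a 1] f) 0 (a 0) b
  have h1 := coeff_pd_iter f 1 (a 1) (b + Finsupp.single 0 (a 0))
  have e : b + Finsupp.single 0 (a 0) + Finsupp.single 1 (a 1) = a + b := by
    ext i; fin_cases i <;> simp [add_comm]
  rw [e] at h1
  have e1 : (b + Finsupp.single (0 : Fin 2) (a 0) : Fin 2 →₀ ℕ) 1 = b 1 := by simp
  rw [e1] at h1
  rw [← mul_assoc, h0]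
  rw [mul_right_comm, h1]
  simp only [Finsupp.add_apply]
  rw [add_comm (b 1), add_comm (b 0)]; ring

lemma apolar_eq_zero_iff {K : Type*} [Field K] [CharZero K] (G f : MvPolynomial (Fin 2) K) :
    apolar G f = 0 ↔ ∀ P, Lam f (G * P) = 0 := by
  constructor
  · intro h P
    rw [P.as_sum, Finset.mul_sum, map_sum]
    refine Finset.sum_eq_zero fun b _ => ?_
    have := apolar_coeff G f b
    rw [h] at this
    have e : monomial b (P.coeff b) = P.coeff b • (monomial b 1 : MvPolynomial (Fin 2) K) := by
      rw [smul_monomial]; simp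
    rw [e, mul_smul_comm, map_smul, ← this]; simp
  · intro h
    ext b
    have := apolar_coeff G f b
    rw [h] at this
    have h2 : ((b 0).factorial * (b 1).factorial : K) ≠ 0 := by
      exact_mod_cast mul_ne_zero (Nat.factorial_ne_zero _) (Nat.factorial_ne_zero _)
    simpa [h2, Nat.factorial_ne_zero] using this

lemma Lam_eq_zero_of_ne {K : Type*} [Field K] {d n : ℕ} (f P : MvPolynomial (Fin 2) K)
    (hf : f.IsHomogeneous d) (hP : P.IsHomogeneous n) (h : n ≠ d) : Lam f P = 0 := by
  rw [P.as_sum, map_sum]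
  refine Finset.sum_eq_zero fun b hb => ?_
  rw [Lam_monomial, hf.coeff_eq_zero, zero_mul, mul_zero]
  rw [Finsupp.degree_eq_weight_one]
  have := hP (mem_support_iff.1 hb)
  exact this ▸ h

lemma apolar_top {K : Type*} [Field K] [CharZero K] {d : ℕ} (G f : MvPolynomial (Fin 2) K)
    (hf : f.IsHomogeneous d) (hG : G.IsHomogeneous d) : apolar G f = 0 ↔ Lam f G = 0 := by
  rw [apolar_eq_zero_iff]
  constructor
  · intro h; simpa using h 1
  · intro h P
    rw [P.as_sum, Finset.mul_sum, map_sum]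
    refine Finset.sum_eq_zero fun b _ => ?_
    by_cases hb : b = 0
    · subst hb
      rw [mul_comm]
      have : (monomial 0 (P.coeff 0) : MvPolynomial (Fin 2) K) * G = P.coeff 0 • G := by
        rw [monomial_zero', C_mul']
      rw [this, map_smul, h, smul_zero]
    · refine Lam_eq_zero_of_ne f _ hf (hG.mul (isHomogeneous_monomial _ rfl)) ?_
      have : b.degree ≠ 0 := by rwa [Ne, Finsupp.degree_eq_zero_iff]
      omega
open Polynomial in
lemma quad_eq {K : Type*} [Field K] (k : K[X]) (hk : k.natDegree ≤ 2) :
    k = k.coeff 0 • 1 + k.coeff 1 • Polynomial.X + k.coeff 2 • Polynomial.X ^ 2 := by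
  conv_lhs => rw [Polynomial.as_sum_range_C_mul_X_pow' k (Nat.lt_succ_of_le hk)]
  simp [Finset.sum_range_succ, Polynomial.smul_eq_C_mul]

open Polynomial in
lemma exists_two {K : Type*} [Field K] (μ ν : K[X] →ₗ[K] K) :
    ∃ y : K[X], y ≠ 0 ∧ y.natDegree ≤ 2 ∧ μ y = 0 ∧ ν y = 0 := by
  have h := LinearMap.ker_ne_bot_of_finrank_lt (K := K)
    (f := ((μ.prod ν).comp (Polynomial.degreeLT K 3).subtype).comp
      (Polynomial.degreeLTEquiv K 3).symm.toLinearMap) (by simp)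
  obtain ⟨c, hc, hc0⟩ := (Submodule.ne_bot_iff _).1 h
  set y := (Polynomial.degreeLTEquiv K 3).symm c with hy
  have hker : (μ (y : K[X]), ν (y : K[X])) = 0 := hc
  refine ⟨y, ?_, ?_, congrArg Prod.fst hker, congrArg Prod.snd hker⟩
  · intro h0
    apply hc0
    have : y = 0 := Subtype.ext h0
    rwa [hy, LinearEquiv.map_eq_zero_iff] at this
  · have := Polynomial.mem_degreeLT.1 y.2
    have h2 : (y : K[X]).degree ≤ (2 : ℕ) := Order.le_of_lt_succ (by exact_mod_cast this)
    exact Polynomial.natDegree_le_of_degree_le h2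

open Polynomial in
lemma lam_quad {K : Type*} [Field K] (lam : K[X] →ₗ[K] K) (H : K[X])
    (h0 : lam H = 0) (h1 : lam (H * Polynomial.X) = 0) (k : K[X]) (hk : k.natDegree ≤ 2) :
    lam (H * k) = k.coeff 2 * lam (H * Polynomial.X ^ 2) := by
  conv_lhs => rw [quad_eq k hk]
  simp only [mul_add, mul_smul_comm, map_add, map_smul, mul_one, h0, h1]
  simp

open Polynomial in
lemma modF_deg {K : Type*} [Field K] (F : K[X]) (hF : F.Monic) (hF3 : F.natDegree = 3) (P : K[X]) :
    (P %ₘ F).natDegree ≤ 2 := by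
  have := Polynomial.natDegree_modByMonic_lt P hF (by rintro rfl; simp at hF3)
  omega

open Polynomial in
/-- Structure of the univariate situation. -/
lemma exists_H {K : Type*} [Field K] (F : K[X]) (hF : F.Monic) (hF3 : F.natDegree = 3)
    (lam : K[X] →ₗ[K] K) (hlF : ∀ P, lam (F * P) = 0)
    (hnd : ∀ G : K[X], G.natDegree ≤ 2 → (∀ P, lam (G * P) = 0) → G = 0) :
    ∃ H : K[X], H.natDegree ≤ 2 ∧ IsCoprime H F ∧ lam H = 0 ∧ lam (H * Polynomial.X) = 0 ∧
      lam (H * Polynomial.X ^ 2) ≠ 0 := by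
  classical
  obtain ⟨H, hH0, hH2, h0, h1⟩ := exists_two lam (lam ∘ₗ LinearMap.mulRight K Polynomial.X)
  simp only [LinearMap.comp_apply, LinearMap.mulRight_apply] at h1
  have h2 : lam (H * Polynomial.X ^ 2) ≠ 0 := by
    intro h2
    apply hH0
    refine hnd H hH2 fun P => ?_
    rw [← Polynomial.modByMonic_add_div P F, mul_add, map_add, mul_left_comm, hlF, add_zero,
      lam_quad lam H h0 h1 _ (modF_deg F hF hF3 P), h2, mul_zero]
  refine ⟨H, hH2, ?_, h0, h1, h2⟩
  by_contra hnc
  obtain ⟨F', hF'⟩ : EuclideanDomain.gcd H F ∣ F := EuclideanDomain.gcd_dvd_right H F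
  obtain ⟨H', hH'⟩ : EuclideanDomain.gcd H F ∣ H := EuclideanDomain.gcd_dvd_left H F
  rw [← EuclideanDomain.gcd_isUnit_iff] at hnc
  generalize EuclideanDomain.gcd H F = D at *
  have hD0 : D ≠ 0 := by rintro rfl; rw [zero_mul] at hH'; exact hH0 hH'
  have hF'0 : F' ≠ 0 := by rintro rfl; rw [mul_zero] at hF'; exact hF.ne_zero hF'
  have hDd : D.natDegree ≠ 0 := by
    intro h
    exact hnc (Polynomial.isUnit_iff_degree_eq_zero.2 (by
      rw [Polynomial.degree_eq_natDegree hD0, h]; rfl))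
  have hdeg : F'.natDegree ≤ 2 := by
    have := congrArg Polynomial.natDegree hF'
    rw [Polynomial.natDegree_mul hD0 hF'0, hF3] at this
    omega
  have hHF : ∀ P, lam (H * (F' * P)) = 0 := by
    intro P
    have : H * (F' * P) = F * (H' * P) := by
      conv_lhs => rw [hH']
      conv_rhs => rw [hF']
      ring
    rw [this, hlF]
  have c2 : F'.coeff 2 = 0 := by
    have := lam_quad lam H h0 h1 F' hdeg
    rw [← mul_one F', hHF 1, mul_one] at this
    exact (mul_eq_zero.1 this.symm).resolve_right h2
  have hdeg1 : F'.natDegree ≤ 1 := by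
    by_contra hcon
    have h22 : F'.natDegree = 2 := by omega
    have := Polynomial.leadingCoeff_ne_zero.2 hF'0
    rw [Polynomial.leadingCoeff, h22] at this
    exact this c2
  have c1 : F'.coeff 1 = 0 := by
    have := lam_quad lam H h0 h1 (F' * Polynomial.X) (Polynomial.natDegree_mul_le.trans (by
      have := Polynomial.natDegree_X_le (R := K); omega))
    rw [hHF, Polynomial.coeff_mul_X] at this
    exact (mul_eq_zero.1 this.symm).resolve_right h2
  have c0 : F'.coeff 0 = 0 := by
    have h3 : F' = Polynomial.C (F'.coeff 0) := by
      conv_lhs => rw [quad_eq F' hdeg, c1, c2]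
      simp [Polynomial.smul_eq_C_mul]
    have := hHF (Polynomial.X ^ 2)
    rw [h3, ← Polynomial.smul_eq_C_mul, mul_smul_comm, map_smul, smul_eq_mul] at this
    exact (mul_eq_zero.1 this).resolve_right h2
  apply hF'0
  rw [quad_eq F' hdeg, c0, c1, c2]; simp

open Polynomial in
lemma decomp {K : Type*} [Field K] (d : ℕ) (hd : 5 ≤ d)
    (F : K[X]) (hF : F.Monic) (hF3 : F.natDegree = 3)
    (lam : K[X] →ₗ[K] K) (hlF : ∀ P, lam (F * P) = 0) (H : K[X]) (hH2 : H.natDegree ≤ 2)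
    (hco : IsCoprime H F) (h0 : lam H = 0) (h1 : lam (H * Polynomial.X) = 0)
    (h2 : lam (H * Polynomial.X ^ 2) ≠ 0) (w : K[X]) (hw : w.natDegree ≤ d) (hlw : lam w = 0) :
    ∃ u l : K[X], u.natDegree ≤ d - 3 ∧ l.natDegree ≤ 1 ∧ w = F * u + H * l := by
  obtain ⟨a, b, hab⟩ := hco
  set k := (a * w) %ₘ F with hk
  have hk2 : k.natDegree ≤ 2 := modF_deg F hF hF3 _
  have hdiv := Polynomial.modByMonic_add_div (a * w) F
  rw [← hk] at hdiv
  have hwe : w = F * (b * w + H * ((a * w) /ₘ F)) + H * k := by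
    linear_combination (-w) * hab - H * hdiv
  set u := b * w + H * ((a * w) /ₘ F)
  have hc : k.coeff 2 = 0 := by
    rw [hwe, map_add, hlF, zero_add, lam_quad lam H h0 h1 k hk2] at hlw
    exact (mul_eq_zero.1 hlw).resolve_right h2
  have hk1 : k.natDegree ≤ 1 := by
    rw [Polynomial.natDegree_le_iff_coeff_eq_zero]
    intro N hN
    by_cases h : N = 2
    · rw [h, hc]
    · exact Polynomial.coeff_eq_zero_of_natDegree_lt (by omega)
  refine ⟨u, k, ?_, hk1, hwe⟩
  by_cases hu : u = 0
  · simp [hu]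
  have h3 : (F * u).natDegree ≤ d := by
    have : F * u = w - H * k := by linear_combination -hwe
    rw [this]
    refine (Polynomial.natDegree_sub_le _ _).trans (max_le hw ?_)
    exact Polynomial.natDegree_mul_le.trans (by omega)
  rw [Polynomial.natDegree_mul hF.ne_zero hu] at h3
  omega

open Polynomial in
lemma core {K : Type*} [Field K] [IsAlgClosed K] [CharZero K] (d : ℕ) (hd : 5 ≤ d)
    (F : K[X]) (hF : F.Monic) (hF3 : F.natDegree = 3)
    (lam : K[X] →ₗ[K] K) (hlF : ∀ P, lam (F * P) = 0)
    (hnd : ∀ G : K[X], G.natDegree ≤ 2 → (∀ P, lam (G * P) = 0) → G = 0)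
    (g : Fin d → K[X]) (hg : LinearIndependent K g)
    (hspan : ∀ w : K[X], w ∈ Submodule.span K (Set.range g) ↔ w.natDegree ≤ d ∧ lam w = 0)
    (q : MvPolynomial (Fin d) K) (hq : q.IsHomogeneous 2) (hq0 : MvPolynomial.aeval g q = 0) :
    q ∈ Submodule.span K {q : MvPolynomial (Fin d) K | q.IsHomogeneous 2 ∧
      MvPolynomial.aeval g q = 0 ∧ rankLE 4 q} := by
  obtain ⟨H, hH2, hco, hl0, hl1, hl2⟩ := exists_H F hF hF3 lam hlF hnd
  have hdec := decomp d hd F hF hF3 lam hlF H hH2 hco hl0 hl1 hl2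
  have hF0 : F ≠ 0 := hF.ne_zero
  -- the linear lift
  obtain ⟨L, hLhom, hLev, hLg⟩ : ∃ L : K[X] →ₗ[K] MvPolynomial (Fin d) K,
      (∀ w, (L w).IsHomogeneous 1) ∧
      (∀ w, w.natDegree ≤ d → lam w = 0 → MvPolynomial.aeval g (L w) = w) ∧
      (∀ i, L (g i) = MvPolynomial.X i) := by
    obtain ⟨ρ, hρ⟩ := LinearMap.exists_leftInverse_of_injective
      (Fintype.linearCombination K g) (LinearMap.ker_eq_bot.2
        (linearIndependent_iff_injective_fintypeLinearCombination.1 hg))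
    have hrg : ∀ i, ρ (g i) = Pi.single i 1 := by
      intro i
      have := LinearMap.congr_fun hρ (Pi.single i 1)
      simpa [Fintype.linearCombination_apply_single] using this
    have hLX : ∀ i, (Fintype.linearCombination K (fun i => (MvPolynomial.X i :
        MvPolynomial (Fin d) K))) (ρ (g i)) = MvPolynomial.X i := by
      intro i
      rw [hrg, Fintype.linearCombination_apply_single, one_smul]
    refine ⟨(Fintype.linearCombination K (fun i => (MvPolynomial.X i : MvPolynomial (Fin d) K)))
      ∘ₗ ρ, ?_, ?_, hLX⟩
    · intro w
      simp only [LinearMap.comp_apply, Fintype.linearCombination_apply]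
      refine MvPolynomial.IsHomogeneous.sum _ _ _ fun i _ => ?_
      rw [← MvPolynomial.C_mul']
      exact MvPolynomial.isHomogeneous_C_mul_X _ _
    · intro w hw hw0
      have hmem := (hspan w).2 ⟨hw, hw0⟩
      induction hmem using Submodule.span_induction with
      | mem x hx =>
        obtain ⟨i, rfl⟩ := hx
        rw [LinearMap.comp_apply, hLX]; simp
      | zero => simp
      | add x y hx hy ihx ihy =>
        rw [map_add, map_add, ihx ((hspan _).1 hx).1 ((hspan _).1 hx).2,
          ihy ((hspan _).1 hy).1 ((hspan _).1 hy).2]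
      | smul a x hx ihx =>
        rw [map_smul, map_smul, ihx ((hspan _).1 hx).1 ((hspan _).1 hx).2]
  set S := Submodule.span K {q : MvPolynomial (Fin d) K | q.IsHomogeneous 2 ∧
      MvPolynomial.aeval g q = 0 ∧ rankLE 4 q} with hS
  -- the bilinear map to the quotient
  let B : K[X] →ₗ[K] K[X] →ₗ[K] (MvPolynomial (Fin d) K ⧸ S) :=
    ((LinearMap.mul K (MvPolynomial (Fin d) K)).compl₁₂ L L).compr₂ S.mkQ
  have hBdef : ∀ u v, B u v = S.mkQ (L u * L v) := fun u v => rfl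
  have hBcomm : ∀ u v, B u v = B v u := fun u v => by rw [hBdef, hBdef, mul_comm]
  have hrel : ∀ u v u' v' : K[X], (u.natDegree ≤ d ∧ lam u = 0) → (v.natDegree ≤ d ∧ lam v = 0) →
      (u'.natDegree ≤ d ∧ lam u' = 0) → (v'.natDegree ≤ d ∧ lam v' = 0) → u * v = u' * v' →
      B u v = B u' v' := by
    intro u v u' v' hu hv hu' hv' huv
    rw [hBdef, hBdef, ← sub_eq_zero, ← map_sub, Submodule.mkQ_apply, Submodule.Quotient.mk_eq_zero]
    refine Submodule.subset_span ⟨?_, ?_, rank4_of _ _ _ _ (hLhom _) (hLhom _) (hLhom _) (hLhom _)⟩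
    · exact ((hLhom u).mul (hLhom v)).sub ((hLhom u').mul (hLhom v'))
    · rw [map_sub, map_mul, map_mul, hLev u hu.1 hu.2, hLev v hv.1 hv.2, hLev u' hu'.1 hu'.2,
        hLev v' hv'.1 hv'.2, huv, sub_self]
  have hFW : ∀ u : K[X], u.natDegree ≤ d - 3 → ((F * u).natDegree ≤ d ∧ lam (F * u) = 0) := by
    intro u hu
    exact ⟨Polynomial.natDegree_mul_le.trans (by omega), hlF u⟩
  have hlin : ∀ l : K[X], l.natDegree ≤ 1 → ∃ a b : K, l = a • 1 + b • Polynomial.X := by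
    intro l hl
    obtain ⟨a, b, h⟩ := Polynomial.exists_eq_X_add_C_of_natDegree_le_one hl
    exact ⟨b, a, by rw [h, Polynomial.smul_eq_C_mul, Polynomial.smul_eq_C_mul]; ring⟩
  have hHW : ∀ l : K[X], l.natDegree ≤ 1 → ((H * l).natDegree ≤ d ∧ lam (H * l) = 0) := by
    intro l hl
    refine ⟨Polynomial.natDegree_mul_le.trans (by omega), ?_⟩
    obtain ⟨a, b, rfl⟩ := hlin l hl
    rw [mul_add, mul_smul_comm, mul_smul_comm, map_add, map_smul, map_smul, mul_one, hl0, hl1]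
    simp
  have hX : ∀ i, (Polynomial.X ^ i : K[X]).natDegree ≤ i := fun i => by simp
  obtain ⟨α, hα⟩ := bil_factor (d - 3) (d - 3)
    (B.compl₁₂ (LinearMap.mulLeft K F) (LinearMap.mulLeft K F)) (by
      intro i j i' j' hi hj hi' hj' hij
      simp only [LinearMap.compl₁₂_apply, LinearMap.mulLeft_apply]
      refine hrel _ _ _ _ (hFW _ ((hX _).trans hi)) (hFW _ ((hX _).trans hj))
        (hFW _ ((hX _).trans hi')) (hFW _ ((hX _).trans hj')) ?_
      rw [mul_mul_mul_comm, ← pow_add, hij, pow_add, mul_mul_mul_comm])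
  obtain ⟨β, hβ⟩ := bil_factor (d - 3) 1
    (B.compl₁₂ (LinearMap.mulLeft K F) (LinearMap.mulLeft K H)) (by
      intro i j i' j' hi hj hi' hj' hij
      simp only [LinearMap.compl₁₂_apply, LinearMap.mulLeft_apply]
      refine hrel _ _ _ _ (hFW _ ((hX _).trans hi)) (hHW _ ((hX _).trans hj))
        (hFW _ ((hX _).trans hi')) (hHW _ ((hX _).trans hj')) ?_
      rw [mul_mul_mul_comm, ← pow_add, hij, pow_add, mul_mul_mul_comm])
  obtain ⟨γ, hγ⟩ := bil_factor 1 1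
    (B.compl₁₂ (LinearMap.mulLeft K H) (LinearMap.mulLeft K H)) (by
      intro i j i' j' hi hj hi' hj' hij
      simp only [LinearMap.compl₁₂_apply, LinearMap.mulLeft_apply]
      refine hrel _ _ _ _ (hHW _ ((hX _).trans hi)) (hHW _ ((hX _).trans hj))
        (hHW _ ((hX _).trans hi')) (hHW _ ((hX _).trans hj')) ?_
      rw [mul_mul_mul_comm, ← pow_add, hij, pow_add, mul_mul_mul_comm])
  simp only [LinearMap.compl₁₂_apply, LinearMap.mulLeft_apply] at hα hβ hγ
  have hB : ∀ u l u' l' : K[X], u.natDegree ≤ d - 3 → l.natDegree ≤ 1 → u'.natDegree ≤ d - 3 →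
      l'.natDegree ≤ 1 → B (F * u + H * l) (F * u' + H * l') =
        α (u * u') + β (u * l' + u' * l) + γ (l * l') := by
    intro u l u' l' hu hl hu' hl'
    rw [map_add B, LinearMap.add_apply, map_add, map_add, hα _ _ hu hu', hβ _ _ hu hl',
      hBcomm (H * l), hβ _ _ hu' hl, hγ _ _ hl hl', map_add]
    abel
  -- the special relation
  have hspec : ∀ x : K[X], x.natDegree ≤ d - 5 → α (x * H) = β (x * F) := by
    obtain ⟨y, hy0, hy2, hly, hly2⟩ := exists_two lam
      (lam ∘ₗ LinearMap.mulRight K (Polynomial.X ^ 2))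
    simp only [LinearMap.comp_apply, LinearMap.mulRight_apply] at hly2
    have hyX : (y * Polynomial.X ^ 2).natDegree ≤ d :=
      Polynomial.natDegree_mul_le.trans (by have := hX 2; omega)
    obtain ⟨g0, k, hg0, hk, hyk⟩ := hdec y (by omega) hly
    obtain ⟨b0, m, hb0, hm, hym⟩ := hdec (y * Polynomial.X ^ 2) hyX hly2
    have hz : F * (b0 - Polynomial.X ^ 2 * g0) + H * (m - Polynomial.X ^ 2 * k) = 0 := by
      linear_combination Polynomial.X ^ 2 * hyk - hym
    have hdvd : F ∣ m - Polynomial.X ^ 2 * k := by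
      refine hco.symm.dvd_of_dvd_mul_left (Dvd.intro (-(b0 - Polynomial.X ^ 2 * g0)) ?_)
      linear_combination -hz
    obtain ⟨e, he⟩ := hdvd
    have hb : b0 - Polynomial.X ^ 2 * g0 = - (H * e) := by
      apply mul_left_cancel₀ hF0
      rw [he] at hz
      linear_combination hz
    have hedeg : e.natDegree = 0 := by
      by_cases he0 : e = 0
      · simp [he0]
      have h1 : (F * e).natDegree = 3 + e.natDegree := by
        rw [Polynomial.natDegree_mul hF0 he0, hF3]
      have h2 : (m - Polynomial.X ^ 2 * k).natDegree ≤ 3 := by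
        refine (Polynomial.natDegree_sub_le _ _).trans (max_le (by omega) ?_)
        exact Polynomial.natDegree_mul_le.trans (by have := hX 2; omega)
      rw [he] at h2
      omega
    obtain ⟨c, rfl⟩ := Polynomial.natDegree_eq_zero.1 hedeg
    have hc : c ≠ 0 := by
      rintro rfl
      have hm' : m = Polynomial.X ^ 2 * k := by
        rw [map_zero, mul_zero] at he
        linear_combination he
      have hk0 : k = 0 := by
        by_contra hk0
        rw [hm', Polynomial.natDegree_mul (by simp) hk0, Polynomial.natDegree_X_pow] at hm
        omega
      rw [hk0, mul_zero, add_zero] at hyk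
      apply hy0
      by_contra hy
      have hg : g0 ≠ 0 := by rintro rfl; simp at hyk; exact hy hyk
      rw [hyk, Polynomial.natDegree_mul hF0 hg] at hy2
      omega
    intro x hx
    have hxX : (x * Polynomial.X ^ 2).natDegree ≤ d - 3 :=
      Polynomial.natDegree_mul_le.trans (by have := hX 2; omega)
    have hr : B (F * x) (y * Polynomial.X ^ 2) = B (F * (x * Polynomial.X ^ 2)) y :=
      hrel _ _ _ _ (hFW x (by omega)) ⟨hyX, hly2⟩ (hFW _ hxX) ⟨by omega, hly⟩ (by ring)
    have e1 := hB x 0 b0 m (by omega) (by simp) hb0 hm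
    have e2 := hB (x * Polynomial.X ^ 2) 0 g0 k hxX (by simp) hg0 hk
    rw [← hym] at e1
    rw [← hyk] at e2
    simp only [mul_zero, add_zero, zero_mul, map_zero] at e1 e2
    rw [e1, e2] at hr
    have h3 : α (x * (b0 - Polynomial.X ^ 2 * g0)) + β (x * (m - Polynomial.X ^ 2 * k)) = 0 := by
      rw [mul_sub, mul_sub, map_sub, map_sub, ← mul_assoc, ← mul_assoc, sub_add_sub_comm, hr,
        sub_self]
    rw [hb, he] at h3
    have r1 : x * -(H * Polynomial.C c) = -(c • (x * H)) := by
      rw [Polynomial.smul_eq_C_mul]; ring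
    have r2 : x * (F * Polynomial.C c) = c • (x * F) := by
      rw [Polynomial.smul_eq_C_mul]; ring
    rw [r1, r2, map_neg, map_smul, map_smul, neg_add_eq_zero] at h3
    exact smul_right_injective _ hc h3
  -- normal form
  have hnf : ∃ a b c : K[X], b.natDegree ≤ d - 2 ∧ c.natDegree ≤ 2 ∧
      S.mkQ q = α a + β b + γ c ∧
      MvPolynomial.aeval g q = F ^ 2 * a + F * H * b + H ^ 2 * c := by
    have hqs : q ∈ Submodule.span K (Set.range fun p : Fin d × Fin d =>
        (MvPolynomial.X p.1 * MvPolynomial.X p.2 : MvPolynomial (Fin d) K)) := by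
      rw [← MvPolynomial.mem_homogeneousSubmodule, ← MvPolynomial.homogeneousSubmodule_one_pow,
        MvPolynomial.homogeneousSubmodule_one_eq_span_X, pow_two, Submodule.span_mul_span] at hq
      refine Submodule.span_mono ?_ hq
      rintro _ ⟨_, ⟨i, rfl⟩, _, ⟨j, rfl⟩, rfl⟩
      exact ⟨(i, j), rfl⟩
    clear hq hq0
    induction hqs using Submodule.span_induction with
    | mem x hx =>
      obtain ⟨⟨i, j⟩, rfl⟩ := hx
      have hi := (hspan (g i)).1 (Submodule.subset_span ⟨i, rfl⟩)
      have hj := (hspan (g j)).1 (Submodule.subset_span ⟨j, rfl⟩)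
      obtain ⟨u, l, hu, hl, hul⟩ := hdec (g i) hi.1 hi.2
      obtain ⟨u', l', hu', hl', hul'⟩ := hdec (g j) hj.1 hj.2
      refine ⟨u * u', u * l' + u' * l, l * l', ?_, ?_, ?_, ?_⟩
      · refine (Polynomial.natDegree_add_le _ _).trans (max_le ?_ ?_)
        · exact Polynomial.natDegree_mul_le.trans (by omega)
        · exact Polynomial.natDegree_mul_le.trans (by omega)
      · exact Polynomial.natDegree_mul_le.trans (by omega)
      · rw [← hB u l u' l' hu hl hu' hl', ← hul, ← hul', hBdef, hLg, hLg]
      · simp only [map_mul, MvPolynomial.aeval_X]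
        rw [hul, hul']; ring
    | zero => exact ⟨0, 0, 0, by simp, by simp, by simp, by simp⟩
    | add x y _ _ ihx ihy =>
      obtain ⟨a, b, c, hb, hc, h1, h2⟩ := ihx
      obtain ⟨a', b', c', hb', hc', h1', h2'⟩ := ihy
      refine ⟨a + a', b + b', c + c', ?_, ?_, ?_, ?_⟩
      · exact (Polynomial.natDegree_add_le _ _).trans (max_le hb hb')
      · exact (Polynomial.natDegree_add_le _ _).trans (max_le hc hc')
      · rw [map_add, h1, h1']; simp only [map_add]; abel
      · rw [map_add, h2, h2']; ring
    | smul r x _ ihx =>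
      obtain ⟨a, b, c, hb, hc, h1, h2⟩ := ihx
      refine ⟨r • a, r • b, r • c, ?_, ?_, ?_, ?_⟩
      · exact (Polynomial.natDegree_smul_le _ _).trans hb
      · exact (Polynomial.natDegree_smul_le _ _).trans hc
      · rw [map_smul, h1]; simp only [map_smul, smul_add]
      · rw [map_smul, h2]; simp only [Polynomial.smul_eq_C_mul]; ring
  obtain ⟨a, b, c, hb, hc, hq1, hq2⟩ := hnf
  rw [hq0] at hq2
  have hc0 : c = 0 := by
    have : F ∣ c := by
      have h' : IsCoprime F (H ^ 2) := hco.symm.pow_right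
      refine h'.dvd_of_dvd_mul_left (Dvd.intro (-(F * a + H * b)) ?_)
      linear_combination hq2
    by_contra hc0
    have := Polynomial.natDegree_le_of_dvd this hc0
    omega
  subst hc0
  have hab : F * a + H * b = 0 := by
    apply mul_left_cancel₀ hF0
    linear_combination -hq2
  obtain ⟨e, he⟩ : F ∣ b := by
    refine hco.symm.dvd_of_dvd_mul_left (Dvd.intro (-a) ?_)
    linear_combination -hab
  have ha : a = -(e * H) := by
    apply mul_left_cancel₀ hF0
    rw [he] at hab
    linear_combination hab
  have hedeg : e.natDegree ≤ d - 5 := by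
    by_cases he0 : e = 0
    · simp [he0]
    rw [he, Polynomial.natDegree_mul hF0 he0] at hb
    omega
  rw [← Submodule.Quotient.mk_eq_zero, ← Submodule.mkQ_apply, hq1, ha, he, map_neg, hspec e hedeg,
    mul_comm F e]
  simp
lemma eval_scale {K : Type*} [Field K] {n : ℕ} (G : MvPolynomial (Fin 2) K)
    (hG : G.IsHomogeneous n) (r : K) (x y : Fin 2 → K) (hxy : ∀ i, y i = r * x i) :
    eval y G = r ^ n * eval x G := by
  rw [eval_eq', eval_eq', Finset.mul_sum]
  refine Finset.sum_congr rfl fun a ha => ?_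
  have : a.degree = n := by
    by_contra h
    exact (mem_support_iff.1 ha) (hG.coeff_eq_zero h)
  rw [← this, Finsupp.degree_eq_sum]
  simp only [Fin.prod_univ_two, Fin.sum_univ_two, hxy, mul_pow, pow_add]
  ring

/-- dehomogenisation after a shear -/
noncomputable def theta {K : Type*} [Field K] (γ : K) :
    MvPolynomial (Fin 2) K →ₐ[K] Polynomial K :=
  aeval ![Polynomial.X, 1 + Polynomial.C γ * Polynomial.X]

lemma theta_inj {K : Type*} [Field K] [Infinite K] (γ : K) {n : ℕ} (G : MvPolynomial (Fin 2) K)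
    (hG : G.IsHomogeneous n) (h : theta γ G = 0) : G = 0 := by
  have h1 : ∀ x : K, eval ![x, 1 + γ * x] G = 0 := by
    intro x
    have := congrArg (Polynomial.aeval x) h
    rw [theta, ← AlgHom.comp_apply, comp_aeval, map_zero] at this
    rw [← this, ← coe_aeval_eq_eval]
    simp only [RingHom.coe_coe]
    congr 2
    ext i
    fin_cases i <;> simp
  have h2 : G * (X 1 - C γ * X 0) = 0 := by
    apply MvPolynomial.funext
    intro v
    simp only [map_mul, map_sub, eval_X, eval_C, map_zero]
    by_cases h0 : v 1 - γ * v 0 = 0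
    · rw [h0, mul_zero]
    · rw [eval_scale G hG (v 1 - γ * v 0) ![v 0 / (v 1 - γ * v 0), 1 + γ * (v 0 / (v 1 - γ * v 0))] v,
        h1, mul_zero, zero_mul]
      intro i
      fin_cases i
      · simp only [Fin.zero_eta, Matrix.cons_val_zero]
        rw [← mul_div_assoc, mul_div_cancel_left₀ _ h0]
      · have h4 : (v 1 - γ * v 0) * (v 0 / (v 1 - γ * v 0)) = v 0 := (by rw [← mul_div_assoc, mul_div_cancel_left₀ _ h0])
        simp only [Fin.mk_one, Matrix.cons_val_one, Matrix.cons_val_fin_one]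
        linear_combination (-γ) * h4
  refine (mul_eq_zero.1 h2).resolve_right fun h3 => ?_
  have := congrArg (eval ![0, 1]) h3
  simp at this

lemma theta_monomial {K : Type*} [Field K] (γ : K) (a : Fin 2 →₀ ℕ) (c : K) :
    theta γ (monomial a c) =
      c • (Polynomial.X ^ a 0 * (1 + Polynomial.C γ * Polynomial.X) ^ a 1) := by
  rw [theta, aeval_monomial, Finsupp.prod_fintype _ _ (by simp)]
  simp [Fin.prod_univ_two, Polynomial.smul_eq_C_mul]

lemma lin_deg {K : Type*} [Field K] (γ : K) :
    (1 + Polynomial.C γ * Polynomial.X : Polynomial K).natDegree ≤ 1 := by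
  compute_degree

lemma theta_natDegree {K : Type*} [Field K] (γ : K) {n : ℕ} (G : MvPolynomial (Fin 2) K)
    (hG : G.IsHomogeneous n) : (theta γ G).natDegree ≤ n := by
  rw [G.as_sum, map_sum]
  refine Polynomial.natDegree_sum_le_of_forall_le _ _ fun a ha => ?_
  have : a.degree = n := by
    by_contra h
    exact (mem_support_iff.1 ha) (hG.coeff_eq_zero h)
  rw [Finsupp.degree_eq_sum, Fin.sum_univ_two] at this
  rw [theta_monomial]
  refine (Polynomial.natDegree_smul_le _ _).trans (Polynomial.natDegree_mul_le.trans ?_)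
  have h1 := Polynomial.natDegree_X_pow_le (R := K) (a 0)
  have h2 := Polynomial.natDegree_pow_le_of_le (a 1) (lin_deg γ)
  omega

lemma theta_coeff {K : Type*} [Field K] (γ : K) {n : ℕ} (G : MvPolynomial (Fin 2) K)
    (hG : G.IsHomogeneous n) : (theta γ G).coeff n = eval ![1, γ] G := by
  rw [eval_eq']
  conv_lhs => rw [G.as_sum, map_sum, Polynomial.finsetSum_coeff]
  refine Finset.sum_congr rfl fun a ha => ?_
  have : a.degree = n := by
    by_contra h
    exact (mem_support_iff.1 ha) (hG.coeff_eq_zero h)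
  rw [Finsupp.degree_eq_sum, Fin.sum_univ_two] at this
  have h1 := Polynomial.natDegree_X_pow_le (R := K) (a 0)
  have h2 := Polynomial.natDegree_pow_le_of_le (a 1) (lin_deg γ)
  have h3 := Polynomial.coeff_pow_of_natDegree_le (m := a 1) (lin_deg γ)
  rw [mul_one] at h2 h3
  rw [theta_monomial, Polynomial.coeff_smul, ← this,
    Polynomial.coeff_mul_add_eq_of_natDegree_le h1 h2, h3]
  simp [Fin.prod_univ_two, Polynomial.coeff_one]

/-- homogenisation -/
noncomputable def eta {K : Type*} [Field K] (γ : K) (n : ℕ) :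
    Polynomial K →ₗ[K] MvPolynomial (Fin 2) K :=
  ∑ i ∈ Finset.range (n + 1),
    (Polynomial.lcoeff K i).smulRight (X 0 ^ i * (X 1 - C γ * X 0) ^ (n - i))

lemma eta_hom {K : Type*} [Field K] (γ : K) (n : ℕ) (P : Polynomial K) :
    (eta γ n P).IsHomogeneous n := by
  rw [eta, LinearMap.sum_apply]
  refine IsHomogeneous.sum _ _ _ fun i hi => ?_
  rw [LinearMap.smulRight_apply, ← C_mul']
  refine IsHomogeneous.C_mul ?_ _
  have h1 : (X 1 - C γ * X 0 : MvPolynomial (Fin 2) K).IsHomogeneous 1 :=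
    (isHomogeneous_X _ _).sub (isHomogeneous_C_mul_X _ _)
  have h2 := (isHomogeneous_X_pow (R := K) (0 : Fin 2) i).mul (h1.pow (n - i))
  have h3 : i + 1 * (n - i) = n := by
    simp only [Finset.mem_range] at hi; omega
  rwa [h3] at h2

lemma theta_eta {K : Type*} [Field K] (γ : K) (n : ℕ) (P : Polynomial K) (hP : P.natDegree ≤ n) :
    theta γ (eta γ n P) = P := by
  conv_rhs => rw [Polynomial.as_sum_range_C_mul_X_pow' P (Nat.lt_succ_of_le hP)]
  rw [eta, LinearMap.sum_apply, map_sum]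
  refine Finset.sum_congr rfl fun i hi => ?_
  rw [LinearMap.smulRight_apply, map_smul, Polynomial.smul_eq_C_mul]
  have h1 : theta γ (X 1 - C γ * X 0) = 1 := by
    simp [theta]
  have h0 : theta γ (X 0) = Polynomial.X := by simp [theta]
  rw [map_mul, map_pow, map_pow, h1, h0, one_pow, mul_one]
  rfl

lemma eta_theta {K : Type*} [Field K] [Infinite K] (γ : K) (n : ℕ) (G : MvPolynomial (Fin 2) K)
    (hG : G.IsHomogeneous n) : eta γ n (theta γ G) = G := by
  rw [← sub_eq_zero]
  refine theta_inj γ _ ((eta_hom γ n _).sub hG) ?_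
  rw [map_sub, theta_eta γ n _ (theta_natDegree γ G hG), sub_self]

lemma exists_gamma {K : Type*} [Field K] [Infinite K] {n : ℕ} (G : MvPolynomial (Fin 2) K)
    (hG : G.IsHomogeneous n) (h0 : G ≠ 0) : ∃ γ : K, eval ![1, γ] G ≠ 0 := by
  by_contra! hcon
  apply h0
  have h2 : G * X 0 = 0 := by
    apply MvPolynomial.funext
    intro v
    simp only [map_mul, eval_X, map_zero]
    by_cases h0 : v 0 = 0
    · rw [h0, mul_zero]
    · rw [eval_scale G hG (v 0) ![1, v 1 / v 0] v, hcon, mul_zero, zero_mul]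
      intro i
      fin_cases i
      · simp
      · simp; field_simp
  exact (mul_eq_zero.1 h2).resolve_right (X_ne_zero _)

theorem stmt10 {K : Type*} [Field K] [IsAlgClosed K] [CharZero K]
    (d : ℕ) (hd : 5 ≤ d) (f : MvPolynomial (Fin 2) K) (hf : f ≠ 0) (hfd : f.IsHomogeneous d)
    (hno2 : ∀ G : MvPolynomial (Fin 2) K, G.IsHomogeneous 2 → apolar G f = 0 → G = 0)
    (hex3 : ∃ G : MvPolynomial (Fin 2) K, G ≠ 0 ∧ G.IsHomogeneous 3 ∧ apolar G f = 0)
    (h : Fin d → MvPolynomial (Fin 2) K) (hind : LinearIndependent K h)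
    (hspan : (Submodule.span K (Set.range h) : Set (MvPolynomial (Fin 2) K))
      = {G | G.IsHomogeneous d ∧ apolar G f = 0}) :
    Ideal.span {q : MvPolynomial (Fin d) K |
        q ∈ RingHom.ker (aeval h : MvPolynomial (Fin d) K →ₐ[K] MvPolynomial (Fin 2) K)
        ∧ q.IsHomogeneous 2}
      = Ideal.span {q : MvPolynomial (Fin d) K |
          q ∈ Ideal.span {q' : MvPolynomial (Fin d) K |
            q' ∈ RingHom.ker (aeval h : MvPolynomial (Fin d) K →ₐ[K] MvPolynomial (Fin 2) K)
            ∧ q'.IsHomogeneous 2}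
          ∧ q.IsHomogeneous 2 ∧ rankLE 4 q} := by
  classical
  have : Infinite K := inferInstance
  have hle : ∀ q : MvPolynomial (Fin d) K,
      q ∈ RingHom.ker (aeval h : MvPolynomial (Fin d) K →ₐ[K] MvPolynomial (Fin 2) K) →
      q.IsHomogeneous 2 →
      q ∈ Submodule.span K {q : MvPolynomial (Fin d) K | q.IsHomogeneous 2 ∧
        aeval h q = 0 ∧ rankLE 4 q} := by
    obtain ⟨F3, hF30, hF3h, hF3a⟩ := hex3
    obtain ⟨γ, hγ⟩ := exists_gamma F3 hF3h hF30
    rw [apolar_eq_zero_iff] at hF3a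
    have hdegle := theta_natDegree γ F3 hF3h
    have hcoef := theta_coeff γ F3 hF3h
    set c := eval ![1, γ] F3 with hc
    have hdeg3 : (theta γ F3).natDegree = 3 :=
      Polynomial.natDegree_eq_of_le_of_coeff_ne_zero hdegle (by rwa [hcoef])
    set F : Polynomial K := theta γ (c⁻¹ • F3) with hFdef
    have hFs : F = Polynomial.C c⁻¹ * theta γ F3 := by
      rw [hFdef, map_smul, Polynomial.smul_eq_C_mul]
    have hF3 : F.natDegree = 3 := by
      rw [hFs, Polynomial.natDegree_C_mul (inv_ne_zero hγ), hdeg3]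
    have hF : F.Monic := by
      rw [Polynomial.Monic, Polynomial.leadingCoeff, hF3, hFs, Polynomial.coeff_C_mul, hcoef,
        inv_mul_cancel₀ hγ]
    have hF1 : F ≠ 1 := by rintro h1; rw [h1] at hF3; simp at hF3
    let lamd : Polynomial K →ₗ[K] K := Lam f ∘ₗ eta γ d
    have hlamd : ∀ G : MvPolynomial (Fin 2) K, G.IsHomogeneous d →
        lamd (theta γ G) = Lam f G := by
      intro G hG
      change Lam f (eta γ d (theta γ G)) = _
      rw [eta_theta γ d G hG]
    have hlamdF : ∀ u : Polynomial K, u.natDegree ≤ d - 3 → lamd (F * u) = 0 := by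
      intro u hu
      rw [← theta_eta γ (d - 3) u hu, hFdef, ← map_mul, hlamd]
      · rw [smul_mul_assoc, map_smul, hF3a, smul_zero]
      · have := (hF3h.C_mul c⁻¹).mul (eta_hom γ (d - 3) u)
        rw [C_mul'] at this
        rwa [show 3 + (d - 3) = d by omega] at this
    let lam : Polynomial K →ₗ[K] K := lamd ∘ₗ Polynomial.modByMonicHom F
    have hlam : ∀ P, lam P = lamd (P %ₘ F) := fun P => rfl
    have hlamlow : ∀ P : Polynomial K, P.natDegree ≤ d → lam P = lamd P := by
      intro P hP
      conv_rhs => rw [← Polynomial.modByMonic_add_div P F]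
      rw [map_add, hlamdF, add_zero, hlam]
      rw [Polynomial.natDegree_divByMonic P hF, hF3]
      omega
    have hlF : ∀ P, lam (F * P) = 0 := by
      intro P
      rw [hlam, (Polynomial.modByMonic_eq_zero_iff_dvd hF).2 (Dvd.intro _ rfl), map_zero]
    have hnd : ∀ G : Polynomial K, G.natDegree ≤ 2 → (∀ P, lam (G * P) = 0) → G = 0 := by
      intro G hG hGP
      have hG' := theta_eta γ 2 G hG
      have hGh := eta_hom γ 2 G
      set G' := eta γ 2 G
      have : G' = 0 := by
        refine hno2 G' hGh ?_
        rw [apolar_eq_zero_iff]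
        intro P
        rw [P.as_sum, Finset.mul_sum, map_sum]
        refine Finset.sum_eq_zero fun b _ => ?_
        have hhom := hGh.mul (isHomogeneous_monomial (P.coeff b) (rfl : b.degree = b.degree))
        by_cases hb : 2 + b.degree = d
        · rw [hb] at hhom
          rw [← hlamd _ hhom, ← hlamlow _ (theta_natDegree γ _ hhom), map_mul, hG', hGP]
        · exact Lam_eq_zero_of_ne f _ hfd hhom hb
      rw [← hG', this, map_zero]
    have hmem : ∀ G, G ∈ Submodule.span K (Set.range h) ↔ G.IsHomogeneous d ∧ apolar G f = 0 := by
      intro G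
      rw [← SetLike.mem_coe, hspan]; rfl
    have hgind : LinearIndependent K (fun i => theta γ (h i)) := by
      refine hind.map (f := (theta γ).toLinearMap) ?_
      rw [Submodule.disjoint_def]
      intro G hG hG0
      exact theta_inj γ G ((hmem G).1 hG).1 hG0
    have hgspan : ∀ w : Polynomial K,
        w ∈ Submodule.span K (Set.range (fun i => theta γ (h i))) ↔ w.natDegree ≤ d ∧ lam w = 0 := by
      intro w
      have e1 : Set.range (fun i => theta γ (h i)) = (theta γ).toLinearMap '' Set.range h := by
        rw [← Set.range_comp]; rfl
      rw [e1, Submodule.span_image, Submodule.mem_map]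
      constructor
      · rintro ⟨G, hG, rfl⟩
        obtain ⟨hGh, hGa⟩ := (hmem G).1 hG
        have hn := theta_natDegree γ G hGh
        refine ⟨hn, ?_⟩
        change lam (theta γ G) = 0
        rw [hlamlow _ hn, hlamd G hGh]
        exact (apolar_top G f hfd hGh).1 hGa
      · rintro ⟨hw, hw0⟩
        have hh := eta_hom γ d w
        refine ⟨eta γ d w, (hmem _).2 ⟨hh, ?_⟩, theta_eta γ d w hw⟩
        rw [apolar_top _ f hfd hh, ← hlamd _ hh, theta_eta γ d w hw, ← hlamlow w hw, hw0]
    have hcomp : ∀ q : MvPolynomial (Fin d) K,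
        aeval (fun i => theta γ (h i)) q = theta γ (aeval h q) := by
      intro q
      rw [← AlgHom.comp_apply, comp_aeval]
    have hhhom : ∀ i, (h i).IsHomogeneous d := fun i =>
      ((hmem (h i)).1 (Submodule.subset_span ⟨i, rfl⟩)).1
    intro q hq hq2
    have hq0 : aeval h q = 0 := hq
    have := core d hd F hF hF3 lam hlF hnd (fun i => theta γ (h i)) hgind hgspan q hq2
      (by rw [hcomp, hq0, map_zero])
    refine Submodule.span_mono ?_ this
    rintro p ⟨hp2, hp0, hpr⟩
    refine ⟨hp2, ?_, hpr⟩
    rw [hcomp] at hp0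
    exact theta_inj γ _ (hp2.aeval h hhhom) hp0
  apply le_antisymm
  · rw [Ideal.span_le]
    rintro q ⟨hq, hq2⟩
    have := hle q hq hq2
    have hsub : Submodule.span K {q : MvPolynomial (Fin d) K | q.IsHomogeneous 2 ∧
        aeval h q = 0 ∧ rankLE 4 q} ≤ (Ideal.span {q : MvPolynomial (Fin d) K |
          q ∈ Ideal.span {q' : MvPolynomial (Fin d) K |
            q' ∈ RingHom.ker (aeval h : MvPolynomial (Fin d) K →ₐ[K] MvPolynomial (Fin 2) K)
            ∧ q'.IsHomogeneous 2}
          ∧ q.IsHomogeneous 2 ∧ rankLE 4 q}).restrictScalars K := by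
      rw [Submodule.span_le]
      rintro p ⟨hp2, hp0, hpr⟩
      exact Ideal.subset_span ⟨Ideal.subset_span ⟨hp0, hp2⟩, hp2, hpr⟩
    exact hsub this
  · rw [Ideal.span_le]
    rintro q ⟨hq, _⟩
    exact hq
end

section
/- Let d ≥ 5 and let f ∈ K[s,t] be a nonzero homogeneous polynomial of degree d such that no nonzero homogeneous polynomial of degree 2 annihilates f, and such that ℓ³∘f = 0 for some nonzero linear form ℓ ∈ K[s,t] (i.e., the trisecant line L meets the projected curve π_p(C_d) in a single triple point). Then for every K-basis h₁,…,h_d of W_f, the K-linear span of the homogeneous quadratic polynomials of rank at most 3 contained in (ker φ_h)₂ has codimension at least 2 in (ker φ_h)₂. In particular, the scheme X = π_p(C_d) ∪ L cut out by the quadrics through π_p(C_d) does not satisfy property QR(3). -/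
open MvPolynomial

lemma coreA {K : Type*} [Field K] (α β : K) (X Y Z : Polynomial K)
    (hX : X.coeff 2 = α * X.coeff 0 + β * X.coeff 1)
    (hY : Y.coeff 2 = α * Y.coeff 0 + β * Y.coeff 1)
    (hX0 : X.coeff 0 = 0) (hY0 : Y.coeff 0 = 0) (hZ0 : Z.coeff 0 ≠ 0) (h : X * Z = Y * Y) :
    (X.coeff 1 * Z.coeff 3 + X.coeff 3 * Z.coeff 1 - 2 * Y.coeff 1 * Y.coeff 3 = 0) ∧
    (X.coeff 1 * Z.coeff 4 + X.coeff 4 * Z.coeff 1 - 2 * Y.coeff 1 * Y.coeff 4 = 0) := by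
  have e1 := congrArg (fun p => Polynomial.coeff p 1) h
  have e2 := congrArg (fun p => Polynomial.coeff p 2) h
  have e3 := congrArg (fun p => Polynomial.coeff p 3) h
  have e4 := congrArg (fun p => Polynomial.coeff p 4) h
  simp [Polynomial.coeff_mul, Finset.Nat.antidiagonal_succ, hX0, hY0] at e1 e2 e3 e4
  have x1 : X.coeff 1 = 0 := by tauto
  have x2 : X.coeff 2 = 0 := by rw [hX, hX0, x1]; ring
  simp [x1, x2] at e2
  have y2 : Y.coeff 2 = 0 := by rw [hY, hY0, e2]; ring
  simp [x1, x2, e2, y2] at e3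
  have x3 : X.coeff 3 = 0 := by tauto
  simp [x1, x2, e2, y2, x3] at e4
  have x4 : X.coeff 4 = 0 := by tauto
  simp [x1, x3, x4, e2]

lemma coreB {K : Type*} [Field K] (α β : K) (X Y Z : Polynomial K)
    (hX : X.coeff 2 = α * X.coeff 0 + β * X.coeff 1)
    (hY : Y.coeff 2 = α * Y.coeff 0 + β * Y.coeff 1)
    (hX0 : X.coeff 0 = 0) (hY0 : Y.coeff 0 = 0) (hZ0 : Z.coeff 0 = 0)
    (hX1 : X.coeff 1 = 0) (hY1 : Y.coeff 1 = 0) (h : X * Z = Y * Y) :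
    (X.coeff 1 * Z.coeff 3 + X.coeff 3 * Z.coeff 1 - 2 * Y.coeff 1 * Y.coeff 3 = 0) ∧
    (X.coeff 1 * Z.coeff 4 + X.coeff 4 * Z.coeff 1 - 2 * Y.coeff 1 * Y.coeff 4 = 0) := by
  have x2 : X.coeff 2 = 0 := by rw [hX, hX0, hX1]; ring
  have y2 : Y.coeff 2 = 0 := by rw [hY, hY0, hY1]; ring
  have e4 := congrArg (fun p => Polynomial.coeff p 4) h
  have e5 := congrArg (fun p => Polynomial.coeff p 5) h
  simp [Polynomial.coeff_mul, Finset.Nat.antidiagonal_succ, hX0, hY0, hZ0, hX1, hY1, x2, y2] at e4 e5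
  rcases e4 with e4 | e4
  · simp [e4] at e5
    rcases e5 with e5 | e5 <;> simp [e4, e5, hX1, hY1]
  · simp [e4, hX1, hY1]

lemma coreC {K : Type*} [Field K] (α β : K) (X Y Z : Polynomial K)
    (hX : X.coeff 2 = α * X.coeff 0 + β * X.coeff 1)
    (hY : Y.coeff 2 = α * Y.coeff 0 + β * Y.coeff 1)
    (hZ : Z.coeff 2 = α * Z.coeff 0 + β * Z.coeff 1)
    (hX0 : X.coeff 0 = 0) (hY0 : Y.coeff 0 = 0) (h : X * Z = Y * Y) :
    (X.coeff 1 * Z.coeff 3 + X.coeff 3 * Z.coeff 1 - 2 * Y.coeff 1 * Y.coeff 3 = 0) ∧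
    (X.coeff 1 * Z.coeff 4 + X.coeff 4 * Z.coeff 1 - 2 * Y.coeff 1 * Y.coeff 4 = 0) := by
  by_cases hZ0 : Z.coeff 0 = 0
  swap
  · exact coreA α β X Y Z hX hY hX0 hY0 hZ0 h
  have e2 := congrArg (fun p => Polynomial.coeff p 2) h
  simp [Polynomial.coeff_mul, Finset.Nat.antidiagonal_succ, hX0, hY0, hZ0] at e2
  by_cases hX1 : X.coeff 1 = 0
  · simp [hX1] at e2
    exact coreB α β X Y Z hX hY hX0 hY0 hZ0 hX1 e2 h
  · obtain ⟨c, hc⟩ : ∃ c, Y.coeff 1 + c * X.coeff 1 = 0 :=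
      ⟨-Y.coeff 1 / X.coeff 1, by field_simp; ring⟩
    have hz1 : Z.coeff 1 + 2 * c * Y.coeff 1 + c ^ 2 * X.coeff 1 = 0 := by
      have : X.coeff 1 * (Z.coeff 1 + 2 * c * Y.coeff 1 + c ^ 2 * X.coeff 1) = 0 := by
        linear_combination e2 + (Y.coeff 1 + c * X.coeff 1) * hc
      exact (mul_eq_zero.mp this).resolve_left hX1
    have := coreB α β (Z + Polynomial.C (2 * c) * Y + Polynomial.C (c ^ 2) * X)
      (Y + Polynomial.C c * X) X
      (by simp only [Polynomial.coeff_add, Polynomial.coeff_C_mul]; rw [hX, hY, hZ]; ring)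
      (by simp only [Polynomial.coeff_add, Polynomial.coeff_C_mul]; rw [hX, hY]; ring)
      (by simp only [Polynomial.coeff_add, Polynomial.coeff_C_mul]; rw [hX0, hY0, hZ0]; ring)
      (by simp only [Polynomial.coeff_add, Polynomial.coeff_C_mul]; rw [hX0, hY0]; ring)
      hX0
      (by simp only [Polynomial.coeff_add, Polynomial.coeff_C_mul]; exact hz1)
      (by simp only [Polynomial.coeff_add, Polynomial.coeff_C_mul]; exact hc)
      (by simp only [map_mul, map_pow, map_ofNat]; linear_combination h)
    simp only [Polynomial.coeff_add, Polynomial.coeff_C_mul] at this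
    constructor
    · linear_combination this.1
    · linear_combination this.2

lemma coreD {K : Type*} [Field K] (α β : K) (X Y Z : Polynomial K)
    (hX : X.coeff 2 = α * X.coeff 0 + β * X.coeff 1)
    (hY : Y.coeff 2 = α * Y.coeff 0 + β * Y.coeff 1)
    (hZ : Z.coeff 2 = α * Z.coeff 0 + β * Z.coeff 1)
    (h : X * Z = Y * Y) :
    (X.coeff 1 * Z.coeff 3 + X.coeff 3 * Z.coeff 1 - 2 * Y.coeff 1 * Y.coeff 3 = 0) ∧
    (X.coeff 1 * Z.coeff 4 + X.coeff 4 * Z.coeff 1 - 2 * Y.coeff 1 * Y.coeff 4 = 0) := by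
  have e0 := congrArg (fun p => Polynomial.coeff p 0) h
  simp [Polynomial.coeff_mul] at e0
  by_cases hX0 : X.coeff 0 = 0
  · simp [hX0] at e0
    exact coreC α β X Y Z hX hY hZ hX0 e0 h
  · obtain ⟨c, hc⟩ : ∃ c, Y.coeff 0 + c * X.coeff 0 = 0 :=
      ⟨-Y.coeff 0 / X.coeff 0, by field_simp; ring⟩
    have hz1 : Z.coeff 0 + 2 * c * Y.coeff 0 + c ^ 2 * X.coeff 0 = 0 := by
      have : X.coeff 0 * (Z.coeff 0 + 2 * c * Y.coeff 0 + c ^ 2 * X.coeff 0) = 0 := by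
        linear_combination e0 + (Y.coeff 0 + c * X.coeff 0) * hc
      exact (mul_eq_zero.mp this).resolve_left hX0
    have := coreC α β (Z + Polynomial.C (2 * c) * Y + Polynomial.C (c ^ 2) * X)
      (Y + Polynomial.C c * X) X
      (by simp only [Polynomial.coeff_add, Polynomial.coeff_C_mul]; rw [hX, hY, hZ]; ring)
      (by simp only [Polynomial.coeff_add, Polynomial.coeff_C_mul]; rw [hX, hY]; ring)
      hX
      (by simp only [Polynomial.coeff_add, Polynomial.coeff_C_mul]; exact hz1)
      (by simp only [Polynomial.coeff_add, Polynomial.coeff_C_mul]; exact hc)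
      (by simp only [map_mul, map_pow, map_ofNat]; linear_combination h)
    simp only [Polynomial.coeff_add, Polynomial.coeff_C_mul] at this
    constructor
    · linear_combination this.1
    · linear_combination this.2

/-- Sum-of-squares version. -/
lemma coreE {K : Type*} [Field K] [IsAlgClosed K] (α β : K) (A B D : Polynomial K)
    (hA : A.coeff 2 = α * A.coeff 0 + β * A.coeff 1)
    (hB : B.coeff 2 = α * B.coeff 0 + β * B.coeff 1)
    (hD : D.coeff 2 = α * D.coeff 0 + β * D.coeff 1)
    (h : A ^ 2 + B ^ 2 + D ^ 2 = 0) :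
    2 * (A.coeff 1 * A.coeff 3 + B.coeff 1 * B.coeff 3 + D.coeff 1 * D.coeff 3) = 0 ∧
    2 * (A.coeff 1 * A.coeff 4 + B.coeff 1 * B.coeff 4 + D.coeff 1 * D.coeff 4) = 0 := by
  obtain ⟨i, hi⟩ := IsAlgClosed.exists_pow_nat_eq (-1 : K) (n := 2) (by norm_num)
  have hi' : (Polynomial.C i) ^ 2 = (-1 : Polynomial K) := by
    rw [← map_pow, hi]; simp
  have := coreD α β (A + Polynomial.C i * B) (Polynomial.C i * D) (A - Polynomial.C i * B)
      (by simp only [Polynomial.coeff_add, Polynomial.coeff_C_mul]; rw [hA, hB]; ring)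
      (by simp only [Polynomial.coeff_C_mul]; rw [hD]; ring)
      (by simp only [Polynomial.coeff_sub, Polynomial.coeff_C_mul]; rw [hA, hB]; ring)
      (by linear_combination h - (B ^ 2 + D ^ 2) * hi')
  simp only [Polynomial.coeff_add, Polynomial.coeff_sub, Polynomial.coeff_C_mul] at this
  constructor
  · linear_combination this.1 + 2 * (B.coeff 1 * B.coeff 3 + D.coeff 1 * D.coeff 3) * hi
  · linear_combination this.2 + 2 * (B.coeff 1 * B.coeff 4 + D.coeff 1 * D.coeff 4) * hi
noncomputable def apD (K : Type*) [Field K] :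
    MvPolynomial (Fin 2) K →ₗ[K] Module.End K (MvPolynomial (Fin 2) K) :=
  (basisMonomials (Fin 2) K).constr K (fun a =>
    ((pderiv (0 : Fin 2)).toLinearMap : Module.End K (MvPolynomial (Fin 2) K)) ^ (a 0) *
    ((pderiv (1 : Fin 2)).toLinearMap : Module.End K (MvPolynomial (Fin 2) K)) ^ (a 1))

lemma apD_monomial {K : Type*} [Field K] (a : Fin 2 →₀ ℕ) (c : K) :
    apD K (monomial a c) = c • (((pderiv (0 : Fin 2)).toLinearMap : Module.End K (MvPolynomial (Fin 2) K)) ^ (a 0) *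
    ((pderiv (1 : Fin 2)).toLinearMap : Module.End K (MvPolynomial (Fin 2) K)) ^ (a 1)) := by
  have h1 : (monomial a c : MvPolynomial (Fin 2) K) = c • (basisMonomials (Fin 2) K a) := by
    simp [smul_monomial]
  rw [h1, map_smul, apD, Module.Basis.constr_basis]

lemma apD_apply {K : Type*} [Field K] (G f : MvPolynomial (Fin 2) K) :
    apolar G f = apD K G f := by
  conv_rhs => rw [G.as_sum]
  rw [map_sum, LinearMap.sum_apply, apolar]
  refine Finset.sum_congr rfl fun a _ => ?_
  rw [apD_monomial, LinearMap.smul_apply, Module.End.mul_apply, Module.End.pow_apply, Module.End.pow_apply]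
  rfl

lemma pderiv_commute {K : Type*} [Field K] :
    Commute ((pderiv (0 : Fin 2)).toLinearMap : Module.End K (MvPolynomial (Fin 2) K))
      ((pderiv (1 : Fin 2)).toLinearMap : Module.End K (MvPolynomial (Fin 2) K)) := by
  have : ⁅(pderiv (0 : Fin 2) : Derivation K (MvPolynomial (Fin 2) K) (MvPolynomial (Fin 2) K)), (pderiv (1 : Fin 2) : Derivation K (MvPolynomial (Fin 2) K) (MvPolynomial (Fin 2) K))⁆ = 0 := by
    apply MvPolynomial.derivation_ext
    intro i
    fin_cases i <;> simp [Derivation.commutator_apply, pderiv_X]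
  have h2 : ∀ p, pderiv (0 : Fin 2) (pderiv (1 : Fin 2) p) = (pderiv (1 : Fin 2) (pderiv (0 : Fin 2) p) : MvPolynomial (Fin 2) K) := by
    intro p
    have := congrArg (fun D => D p) this
    rw [Derivation.commutator_apply] at this
    exact sub_eq_zero.mp this
  exact LinearMap.ext h2

lemma apD_mul {K : Type*} [Field K] (G H : MvPolynomial (Fin 2) K) :
    apD K (G * H) = apD K G * apD K H := by
  induction G using MvPolynomial.induction_on' with
  | add p q hp hq => rw [add_mul, map_add, hp, hq, map_add, add_mul]
  | monomial a c =>
    induction H using MvPolynomial.induction_on' with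
    | add p q hp hq => rw [mul_add, map_add, hp, hq, map_add, mul_add]
    | monomial b e =>
      rw [monomial_mul, apD_monomial, apD_monomial, apD_monomial, smul_mul_smul_comm,
        Finsupp.add_apply, Finsupp.add_apply, pow_add, pow_add]
      congr 1
      have := (pderiv_commute (K := K)).pow_pow (b 0) (a 1)
      rw [mul_assoc, mul_assoc]
      congr 1
      rw [← mul_assoc, ← mul_assoc, this.eq]

lemma apD_one {K : Type*} [Field K] : apD K (1 : MvPolynomial (Fin 2) K) = 1 := by
  rw [← C_1, ← monomial_zero', apD_monomial]; simp

lemma apD_C_mul {K : Type*} [Field K] (c : K) (G : MvPolynomial (Fin 2) K) :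
    apD K (C c * G) = c • apD K G := by
  rw [C_mul', map_smul]

lemma apD_X0 {K : Type*} [Field K] (f : MvPolynomial (Fin 2) K) :
    apD K (X 0) f = pderiv 0 f := by
  rw [X, apD_monomial]; simp

lemma apD_X1 {K : Type*} [Field K] (f : MvPolynomial (Fin 2) K) :
    apD K (X 1) f = pderiv 1 f := by
  rw [X, apD_monomial]; simp

lemma apD_homog {K : Type*} [Field K] (G f : MvPolynomial (Fin 2) K) (m n : ℕ)
    (hG : G.IsHomogeneous m) (hf : f.IsHomogeneous n) : (apD K G f).IsHomogeneous (n - m) := by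
  have key : ∀ (i : Fin 2) (k N : ℕ) (p : MvPolynomial (Fin 2) K), p.IsHomogeneous N →
      ((((pderiv i).toLinearMap : Module.End K (MvPolynomial (Fin 2) K)) ^ k) p).IsHomogeneous (N - k) := by
    intro i k
    induction k with
    | zero => intro N p hp; simpa using hp
    | succ k ih =>
      intro N p hp
      rw [pow_succ, Module.End.mul_apply]
      have := ih (N - 1) (pderiv i p) hp.pderiv
      rwa [Nat.sub_sub, add_comm 1 k] at this
  rw [G.as_sum, map_sum, LinearMap.sum_apply]
  refine IsHomogeneous.sum _ _ _ fun a ha => ?_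
  rw [apD_monomial, LinearMap.smul_apply, smul_eq_C_mul, Module.End.mul_apply]
  apply IsHomogeneous.C_mul
  have h1 := key 0 (a 0) _ _ (key 1 (a 1) n f hf)
  have h2 : a.degree = m := (hG.degree_eq_sum_deg_support ha).symm ▸ rfl
  rw [Finsupp.degree_eq_sum, Fin.sum_univ_two] at h2
  rwa [Nat.sub_sub, add_comm (a 1), h2] at h1

lemma apD_nondeg {K : Type*} [Field K] [CharZero K] (l m : MvPolynomial (Fin 2) K) (a b c e : K)
    (h0 : X 0 = C b * m - C e * l) (h1 : X 1 = C c * l - C a * m) (hm : m.IsHomogeneous 1) (n : ℕ) :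
    ∀ g : MvPolynomial (Fin 2) K, g.IsHomogeneous n → apD K l g = 0 → apD K (m ^ n) g = 0 → g = 0 := by
  induction n with
  | zero => intro g _ _ h; simpa [apD_one] using h
  | succ n ih =>
    intro g hg hl hmg
    have hmg0 : apD K m g = 0 := by
      apply ih (apD K m g)
      · simpa using apD_homog m g 1 (n + 1) hm hg
      · rw [← Module.End.mul_apply, ← apD_mul, mul_comm, apD_mul, Module.End.mul_apply, hl, map_zero]
      · rw [← Module.End.mul_apply, ← apD_mul, ← pow_succ, hmg]
    have d0 : pderiv 0 g = 0 := by
      rw [← apD_X0, h0, map_sub, apD_C_mul, apD_C_mul]; simp [hl, hmg0]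
    have d1 : pderiv 1 g = 0 := by
      rw [← apD_X1, h1, map_sub, apD_C_mul, apD_C_mul]; simp [hl, hmg0]
    have := hg.sum_X_mul_pderiv
    rw [Fin.sum_univ_two, d0, d1] at this
    have h6 : ((n + 1 : ℕ) : K) • g = 0 := by
      rw [Nat.cast_smul_eq_nsmul, ← this]; simp
    exact (smul_eq_zero.mp h6).resolve_left (by exact_mod_cast Nat.succ_ne_zero n)

lemma hom_expand {K : Type*} [Field K] (d : ℕ) (G : MvPolynomial (Fin 2) K) (hG : G.IsHomogeneous d) :
    G = ∑ i ∈ Finset.range (d + 1),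
      C ((aeval ![1, Polynomial.X] G : Polynomial K).coeff i) * X 0 ^ (d - i) * X 1 ^ i := by
  conv_rhs =>
    enter [2, i]
    rw [G.as_sum, map_sum, Polynomial.finsetSum_coeff, map_sum, Finset.sum_mul, Finset.sum_mul]
  rw [Finset.sum_comm]
  conv_lhs => rw [G.as_sum]
  refine Finset.sum_congr rfl fun a ha => ?_
  have h2 : a.degree = d := (hG.degree_eq_sum_deg_support ha).symm ▸ rfl
  rw [Finsupp.degree_eq_sum, Fin.sum_univ_two] at h2
  have : ∀ i, (aeval ![1, Polynomial.X] (monomial a (coeff a G)) : Polynomial K).coeff i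
      = if i = a 1 then coeff a G else 0 := by
    intro i
    rw [aeval_monomial, Finsupp.prod_fintype _ _ (by simp), Fin.prod_univ_two]
    simp [Polynomial.coeff_C_mul, Polynomial.coeff_X_pow]
  simp_rw [this]
  rw [Finset.sum_eq_single (a 1)]
  · rw [monomial_eq, Finsupp.prod_fintype _ _ (by simp), Fin.prod_univ_two]
    have : d - a 1 = a 0 := by omega
    simp [this, mul_assoc]
  · intro i _ hi; simp [hi]
  · intro hi; exact absurd (Finset.mem_range.mpr (by omega)) hi

/-- Dehomogenization in the coordinates `m = 1`, `l = T`. -/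
noncomputable def rho {K : Type*} [Field K] (a b c e : K) : MvPolynomial (Fin 2) K →ₐ[K] Polynomial K :=
  aeval ![Polynomial.C b - Polynomial.C e * Polynomial.X, Polynomial.C c * Polynomial.X - Polynomial.C a]

lemma rho_expand {K : Type*} [Field K] (l m : MvPolynomial (Fin 2) K) (a b c e : K)
    (h0 : X 0 = C b * m - C e * l) (h1 : X 1 = C c * l - C a * m)
    (d : ℕ) (G : MvPolynomial (Fin 2) K) (hG : G.IsHomogeneous d) :
    G = ∑ i ∈ Finset.range (d + 1), C ((rho a b c e G).coeff i) * m ^ (d - i) * l ^ i := by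
  set τ : MvPolynomial (Fin 2) K →ₐ[K] MvPolynomial (Fin 2) K :=
    aeval ![C b * X 0 - C e * X 1, C c * X 1 - C a * X 0] with hτ
  set σ : MvPolynomial (Fin 2) K →ₐ[K] MvPolynomial (Fin 2) K := aeval ![m, l] with hσ
  have hst : σ.comp τ = AlgHom.id K _ := by
    apply MvPolynomial.algHom_ext
    intro i
    fin_cases i
    · have : σ (τ (X 0)) = X 0 := by
        simp [hσ, hτ, algHom_C, ← h0]
      exact this
    · have : σ (τ (X 1)) = X 1 := by
        simp [hσ, hτ, algHom_C, ← h1]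
      exact this
  have hr : ∀ p, (aeval ![1, Polynomial.X] (τ p) : Polynomial K) = rho a b c e p := by
    intro p
    have : (aeval ![1, Polynomial.X] : MvPolynomial (Fin 2) K →ₐ[K] Polynomial K).comp τ = rho a b c e := by
      apply MvPolynomial.algHom_ext
      intro i
      fin_cases i <;> simp [hτ, rho, algHom_C]
    rw [← this]; rfl
  have hτG : (τ G).IsHomogeneous d := by
    have := hG.aeval (![C b * X 0 - C e * X 1, C c * X 1 - C a * X 0] : Fin 2 → MvPolynomial (Fin 2) K) (n := 1) (by
      intro i
      fin_cases i
      · exact (isHomogeneous_C_mul_X _ _).sub (isHomogeneous_C_mul_X _ _)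
      · exact (isHomogeneous_C_mul_X _ _).sub (isHomogeneous_C_mul_X _ _))
    rwa [one_mul] at this
  have h3 := congrArg σ (hom_expand d (τ G) hτG)
  have h4 : σ (τ G) = G := congrArg (fun F => F G) hst
  rw [h4, map_sum] at h3
  conv_lhs => rw [h3]
  refine Finset.sum_congr rfl fun i _ => ?_
  rw [hr]
  simp [hσ, algHom_C]

lemma geom_data {K : Type*} [Field K] [CharZero K]
    (d : ℕ) (hd : 5 ≤ d) (f : MvPolynomial (Fin 2) K) (hfd : f.IsHomogeneous d)
    (hno2 : ∀ G : MvPolynomial (Fin 2) K, G.IsHomogeneous 2 → apolar G f = 0 → G = 0)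
    (hex3 : ∃ ℓ : MvPolynomial (Fin 2) K, ℓ ≠ 0 ∧ ℓ.IsHomogeneous 1 ∧ apolar (ℓ ^ 3) f = 0) :
    ∃ (α β : K) (ρ : MvPolynomial (Fin 2) K →ₐ[K] Polynomial K) (E0 E1 E3 E4 E5 : MvPolynomial (Fin 2) K),
      (∀ G : MvPolynomial (Fin 2) K, G.IsHomogeneous d → apolar G f = 0 →
        (ρ G).coeff 2 = α * (ρ G).coeff 0 + β * (ρ G).coeff 1) ∧
      (E0.IsHomogeneous d ∧ apolar E0 f = 0 ∧ ρ E0 = 1 + Polynomial.C α * Polynomial.X ^ 2) ∧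
      (E1.IsHomogeneous d ∧ apolar E1 f = 0 ∧ ρ E1 = Polynomial.X + Polynomial.C β * Polynomial.X ^ 2) ∧
      (E3.IsHomogeneous d ∧ apolar E3 f = 0 ∧ ρ E3 = Polynomial.X ^ 3) ∧
      (E4.IsHomogeneous d ∧ apolar E4 f = 0 ∧ ρ E4 = Polynomial.X ^ 4) ∧
      (E5.IsHomogeneous d ∧ apolar E5 f = 0 ∧ ρ E5 = Polynomial.X ^ 5) ∧
      E0 * E4 - E1 * E3 + C β * (E0 * E5) - C α * (E3 * E3) - C (α * β) * (E3 * E4) = 0 ∧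
      E0 * E5 - E1 * E4 + C β * (E3 * E3) - C α * (E3 * E4) = 0 := by
  obtain ⟨l, hl0, hl, hl3⟩ := hex3
  rw [apD_apply] at hl3
  obtain ⟨a, b, hab⟩ : ∃ a b : K, l = C a * X 0 + C b * X 1 := by
    have := hom_expand 1 l hl
    simp [Finset.sum_range_succ] at this
    exact ⟨_, _, this⟩
  obtain ⟨c, e, hce⟩ : ∃ c e : K, c * b - e * a = 1 := by
    by_cases ha : a = 0
    · have hb : b ≠ 0 := by
        rintro rfl; apply hl0; rw [hab, ha]; simp
      exact ⟨b⁻¹, 0, by field_simp; ring⟩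
    · exact ⟨0, -a⁻¹, by field_simp; ring⟩
  set m : MvPolynomial (Fin 2) K := C c * X 0 + C e * X 1 with hm
  have hmh : m.IsHomogeneous 1 := (isHomogeneous_C_mul_X _ _).add (isHomogeneous_C_mul_X _ _)
  have hceC : (C c * C b - C e * C a : MvPolynomial (Fin 2) K) = 1 := by
    rw [← C_mul, ← C_mul, ← C_sub, hce, C_1]
  have h0 : X 0 = C b * m - C e * l := by
    rw [hm, hab]; linear_combination (-X 0 : MvPolynomial (Fin 2) K) * hceC
  have h1 : X 1 = C c * l - C a * m := by
    rw [hm, hab]; linear_combination (-X 1 : MvPolynomial (Fin 2) K) * hceC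
  have hceP : (Polynomial.C c * Polynomial.C b - Polynomial.C e * Polynomial.C a : Polynomial K) = 1 := by
    rw [← Polynomial.C_mul, ← Polynomial.C_mul, ← Polynomial.C_sub, hce, Polynomial.C_1]
  have rC : ∀ x, rho a b c e (C x) = Polynomial.C x := fun x => algHom_C _ x
  have rX0 : rho a b c e (X 0) = Polynomial.C b - Polynomial.C e * Polynomial.X := by
    simp [rho]
  have rX1 : rho a b c e (X 1) = Polynomial.C c * Polynomial.X - Polynomial.C a := by
    simp [rho]
  have rl : rho a b c e l = Polynomial.X := by
    rw [hab, map_add, map_mul, map_mul, rC, rC, rX0, rX1]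
    linear_combination Polynomial.X * hceP
  have rm : rho a b c e m = 1 := by
    rw [hm, map_add, map_mul, map_mul, rC, rC, rX0, rX1]
    linear_combination hceP
  have hh : ∀ i, i ≤ d → (m ^ (d - i) * l ^ i).IsHomogeneous d := by
    intro i hi
    have := (hmh.pow (d - i)).mul (hl.pow i)
    rwa [one_mul, one_mul, Nat.sub_add_cancel hi] at this
  have hge : ∀ k i, 3 ≤ i → apD K (m ^ k * l ^ i) f = 0 := by
    intro k i hi
    obtain ⟨j, rfl⟩ := Nat.exists_eq_add_of_le' hi
    rw [pow_add, ← mul_assoc, apD_mul, Module.End.mul_apply, hl3, map_zero]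
  have hconst : ∀ i, i ≤ d → ∃ x : K, apD K (m ^ (d - i) * l ^ i) f = C x := by
    intro i hi
    have := apD_homog _ f d d (hh i hi) hfd
    rw [Nat.sub_self, ← totalDegree_zero_iff_isHomogeneous] at this
    exact ⟨_, totalDegree_eq_zero_iff_eq_C.mp this⟩
  obtain ⟨c0, hc0⟩ := hconst 0 (by omega)
  obtain ⟨c1, hc1⟩ := hconst 1 (by omega)
  obtain ⟨c2, hc2⟩ := hconst 2 (by omega)
  have hc2ne : c2 ≠ 0 := by
    rintro rfl
    have hg : apD K (l ^ 2) f = 0 := by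
      apply apD_nondeg l m a b c e h0 h1 hmh (d - 2) (apD K (l ^ 2) f)
      · exact apD_homog _ f 2 d (by simpa using hl.pow 2) hfd
      · rw [← Module.End.mul_apply, ← apD_mul, ← pow_succ', hl3]
      · rw [← Module.End.mul_apply, ← apD_mul, hc2, C_0]
    have := hno2 (l ^ 2) (by simpa using hl.pow 2) (by rw [apD_apply, hg])
    exact hl0 (pow_eq_zero_iff (two_ne_zero) |>.mp this)
  obtain ⟨n, rfl⟩ := Nat.exists_eq_add_of_le' hd
  refine ⟨-c0 / c2, -c1 / c2, rho a b c e,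
    m ^ (n + 5 - 0) * l ^ 0 + C (-c0 / c2) * (m ^ (n + 5 - 2) * l ^ 2),
    m ^ (n + 5 - 1) * l ^ 1 + C (-c1 / c2) * (m ^ (n + 5 - 2) * l ^ 2),
    m ^ (n + 5 - 3) * l ^ 3, m ^ (n + 5 - 4) * l ^ 4, m ^ (n + 5 - 5) * l ^ 5, ?_, ⟨?_, ?_, ?_⟩, ⟨?_, ?_, ?_⟩,
    ⟨hh 3 (by omega), ?_, ?_⟩, ⟨hh 4 (by omega), ?_, ?_⟩, ⟨hh 5 (by omega), ?_, ?_⟩, ?_, ?_⟩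
  · intro G hG hGf
    rw [apD_apply, rho_expand l m a b c e h0 h1 (n + 5) G hG, map_sum, LinearMap.sum_apply] at hGf
    have hs : (n + 5 + 1) = (n + 3) + 3 := by ring
    rw [hs, Finset.sum_range_succ', Finset.sum_range_succ', Finset.sum_range_succ', Finset.sum_eq_zero] at hGf
    · simp only [mul_assoc, apD_C_mul, LinearMap.smul_apply] at hGf
      simp only [zero_add] at hGf
      norm_num only at hGf
      rw [hc0, hc1, hc2] at hGf
      simp only [smul_eq_C_mul, ← C_mul, ← C_add] at hGf
      rw [← C_0] at hGf
      have := C_injective _ _ hGf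
      field_simp
      linear_combination this
    · intro i _
      rw [mul_assoc, apD_C_mul, LinearMap.smul_apply, hge _ _ (by omega), smul_zero]
  · exact (hh 0 (by omega)).add ((hh 2 (by omega)).C_mul _)
  · rw [apD_apply, map_add, apD_C_mul, LinearMap.add_apply, LinearMap.smul_apply, hc0, hc2,
      smul_eq_C_mul, ← C_mul, ← C_add, ← C_0]
    congr 1; field_simp; ring
  · simp only [map_add, map_mul, map_pow, rC, rl, rm]; simp
  · exact (hh 1 (by omega)).add ((hh 2 (by omega)).C_mul _)
  · rw [apD_apply, map_add, apD_C_mul, LinearMap.add_apply, LinearMap.smul_apply, hc1, hc2,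
      smul_eq_C_mul, ← C_mul, ← C_add, ← C_0]
    congr 1; field_simp; ring
  · simp only [map_add, map_mul, map_pow, rC, rl, rm]; simp
  · rw [apD_apply, hge _ _ (by omega)]
  · simp only [map_mul, map_pow, rl, rm]; simp
  · rw [apD_apply, hge _ _ (by omega)]
  · simp only [map_mul, map_pow, rl, rm]; simp
  · rw [apD_apply, hge _ _ (by omega)]
  · simp only [map_mul, map_pow, rl, rm]; simp
  · simp only [Nat.add_sub_cancel, Nat.sub_zero, C_mul, show n + 5 - 1 = n + 4 by omega,
      show n + 5 - 2 = n + 3 by omega, show n + 5 - 3 = n + 2 by omega, show n + 5 - 4 = n + 1 by omega]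
    ring
  · simp only [Nat.add_sub_cancel, Nat.sub_zero, show n + 5 - 1 = n + 4 by omega,
      show n + 5 - 2 = n + 3 by omega, show n + 5 - 3 = n + 2 by omega, show n + 5 - 4 = n + 1 by omega]
    ring

lemma eval_lin {K : Type*} [Field K] {d : ℕ} (h : Fin d → MvPolynomial (Fin 2) K)
    (L : MvPolynomial (Fin 2) K →ₗ[K] K) (l : MvPolynomial (Fin d) K) (hl : l.IsHomogeneous 1) :
    eval (fun i => L (h i)) l = L (aeval h l) := by
  have hl' : l ∈ Submodule.span K (Set.range (X : Fin d → MvPolynomial (Fin d) K)) := by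
    rw [← homogeneousSubmodule_one_eq_span_X]; exact hl
  induction hl' using Submodule.span_induction with
  | mem x hx => obtain ⟨i, rfl⟩ := hx; simp
  | zero => simp
  | add x y hx hy h1 h2 =>
    rw [homogeneousSubmodule_one_eq_span_X.symm] at hx hy
    rw [map_add, map_add, map_add, h1 hx, h2 hy]
  | smul c x hx h1 =>
    rw [homogeneousSubmodule_one_eq_span_X.symm] at hx
    rw [smul_eval, h1 hx, map_smul, map_smul, smul_eq_mul]

/-- The polarized evaluation functional. -/
noncomputable def polarL {K : Type*} [Field K] {d : ℕ} (h : Fin d → MvPolynomial (Fin 2) K)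
    (L M : MvPolynomial (Fin 2) K →ₗ[K] K) : MvPolynomial (Fin d) K →ₗ[K] K :=
  (aeval (fun i => (L + M) (h i)) : MvPolynomial (Fin d) K →ₐ[K] K).toLinearMap
  - (aeval (fun i => L (h i)) : MvPolynomial (Fin d) K →ₐ[K] K).toLinearMap
  - (aeval (fun i => M (h i)) : MvPolynomial (Fin d) K →ₐ[K] K).toLinearMap

lemma polarL_mul {K : Type*} [Field K] {d : ℕ} (h : Fin d → MvPolynomial (Fin 2) K)
    (L M : MvPolynomial (Fin 2) K →ₗ[K] K) (p q : MvPolynomial (Fin d) K)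
    (hp : p.IsHomogeneous 1) (hq : q.IsHomogeneous 1) :
    polarL h L M (p * q) = L (aeval h p) * M (aeval h q) + M (aeval h p) * L (aeval h q) := by
  simp only [polarL, LinearMap.sub_apply, AlgHom.toLinearMap_apply, map_mul, aeval_eq_eval]
  rw [eval_lin h _ p hp, eval_lin h _ q hq, eval_lin h _ p hp, eval_lin h _ q hq, eval_lin h _ p hp,
    eval_lin h _ q hq]
  simp only [LinearMap.add_apply]
  ring

lemma comp_two {K : Type*} [Field K] {d : ℕ} (S : Set (MvPolynomial (Fin d) K))
    (hS : ∀ q ∈ S, q.IsHomogeneous 2) (p : MvPolynomial (Fin d) K) (hp : p ∈ Ideal.span S) :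
    homogeneousComponent 2 p ∈ Submodule.span K S := by
  have key : ∀ (r s : MvPolynomial (Fin d) K), s ∈ S →
      homogeneousComponent 2 (r * s) ∈ Submodule.span K S := by
    intro r s hs
    induction r using MvPolynomial.induction_on' with
    | add p q hp hq => rw [add_mul, map_add]; exact add_mem hp hq
    | monomial a c =>
      have hm := (isHomogeneous_monomial (d := a) c rfl).mul (hS s hs)
      rw [homogeneousComponent_of_mem hm]
      split_ifs with h2
      · have : a = 0 := by
          rw [← Finsupp.degree_eq_zero_iff]; omega
        rw [this, monomial_zero', C_mul']
        exact Submodule.smul_mem _ _ (Submodule.subset_span hs)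
      · exact zero_mem _
  obtain ⟨t, ht⟩ := (Submodule.mem_span_set').mp hp
  obtain ⟨F, g, rfl⟩ := ht
  rw [map_sum]
  exact sum_mem fun i _ => key _ _ (g i).2

theorem stmt11 {K : Type*} [Field K] [IsAlgClosed K] [CharZero K]
    (d : ℕ) (hd : 5 ≤ d) (f : MvPolynomial (Fin 2) K) (hf : f ≠ 0) (hfd : f.IsHomogeneous d)
    (hno2 : ∀ G : MvPolynomial (Fin 2) K, G.IsHomogeneous 2 → apolar G f = 0 → G = 0)
    (hex3 : ∃ ℓ : MvPolynomial (Fin 2) K, ℓ ≠ 0 ∧ ℓ.IsHomogeneous 1 ∧ apolar (ℓ ^ 3) f = 0)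
    (h : Fin d → MvPolynomial (Fin 2) K) (hind : LinearIndependent K h)
    (hspan : (Submodule.span K (Set.range h) : Set (MvPolynomial (Fin 2) K))
      = {G | G.IsHomogeneous d ∧ apolar G f = 0}) :
    Module.finrank K (Submodule.span K {q : MvPolynomial (Fin d) K |
        q ∈ RingHom.ker (aeval h : MvPolynomial (Fin d) K →ₐ[K] MvPolynomial (Fin 2) K)
        ∧ q.IsHomogeneous 2 ∧ rankLE 3 q}) + 2
      ≤ Module.finrank K
          (((RingHom.ker (aeval h : MvPolynomial (Fin d) K →ₐ[K] MvPolynomial (Fin 2) K)).restrictScalars K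
            ⊓ homogeneousSubmodule (Fin d) K 2 : Submodule K (MvPolynomial (Fin d) K)))
    ∧ ¬ ∃ S : Set (MvPolynomial (Fin d) K),
        (∀ q ∈ S, q.IsHomogeneous 2 ∧ rankLE 3 q) ∧
        Ideal.span S = Ideal.span {q : MvPolynomial (Fin d) K |
          q ∈ RingHom.ker (aeval h : MvPolynomial (Fin d) K →ₐ[K] MvPolynomial (Fin 2) K)
          ∧ q.IsHomogeneous 2} := by
  obtain ⟨α, β, ρ, E0, E1, E3, E4, E5, hrel, ⟨a0, b0, r0⟩, ⟨a1, b1, r1⟩, ⟨a3, b3, r3⟩,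
    ⟨a4, b4, r4⟩, ⟨a5, b5, r5⟩, id1, id2⟩ := geom_data d hd f hfd hno2 hex3
  -- the coefficient functionals
  let lam : ℕ → (MvPolynomial (Fin 2) K →ₗ[K] K) := fun k => (Polynomial.lcoeff K k).comp ρ.toLinearMap
  have hlam : ∀ k G, lam k G = (ρ G).coeff k := fun k G => rfl
  let c3 := polarL h (lam 1) (lam 3)
  let c4 := polarL h (lam 1) (lam 4)
  -- linear forms map to elements of `W_f`
  have hlin : ∀ l : MvPolynomial (Fin d) K, l.IsHomogeneous 1 →
      (ρ (aeval h l)).coeff 2 = α * (ρ (aeval h l)).coeff 0 + β * (ρ (aeval h l)).coeff 1 := by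
    intro l hl
    have hmem : aeval h l ∈ (Submodule.span K (Set.range h) : Set (MvPolynomial (Fin 2) K)) := by
      have hl' : l ∈ Submodule.span K (Set.range (X : Fin d → MvPolynomial (Fin d) K)) := by
        rw [← homogeneousSubmodule_one_eq_span_X]; exact hl
      have h2 := Submodule.mem_map_of_mem (f := (aeval h : MvPolynomial (Fin d) K →ₐ[K] MvPolynomial (Fin 2) K).toLinearMap) hl'
      rw [Submodule.map_span, ← Set.range_comp] at h2
      have h3 : ((aeval h : MvPolynomial (Fin d) K →ₐ[K] MvPolynomial (Fin 2) K).toLinearMap ∘ X) = h := by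
        funext i; simp
      rw [h3] at h2
      exact h2
    rw [hspan] at hmem
    exact hrel _ hmem.1 hmem.2
  -- elements of `W_f` lift to linear forms
  have hlift : ∀ G : MvPolynomial (Fin 2) K, G.IsHomogeneous d → apolar G f = 0 →
      ∃ l : MvPolynomial (Fin d) K, l.IsHomogeneous 1 ∧ aeval h l = G := by
    intro G h1 h2
    have : G ∈ (Submodule.span K (Set.range h) : Set (MvPolynomial (Fin 2) K)) := by
      rw [hspan]; exact ⟨h1, h2⟩
    obtain ⟨c, hc⟩ := (Submodule.mem_span_range_iff_exists_fun K).mp this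
    refine ⟨∑ i, C (c i) * X i, IsHomogeneous.sum _ _ _ fun i _ => isHomogeneous_C_mul_X _ _, ?_⟩
    rw [map_sum, ← hc]
    refine Finset.sum_congr rfl fun i _ => ?_
    rw [C_mul', map_smul, aeval_X]
  -- the functionals kill quadrics of rank at most 3
  have hkill : ∀ q : MvPolynomial (Fin d) K, aeval h q = 0 → rankLE 3 q → c3 q = 0 ∧ c4 q = 0 := by
    rintro q hq ⟨l, hl, rfl⟩
    rw [Fin.sum_univ_three] at hq ⊢
    have hq' := congrArg ρ hq
    simp only [map_add, map_pow, map_zero] at hq'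
    have := coreE α β _ _ _ (hlin _ (hl 0)) (hlin _ (hl 1)) (hlin _ (hl 2)) hq'
    simp only [c3, c4, sq, map_add, polarL_mul h _ _ _ _ (hl 0) (hl 0), polarL_mul h _ _ _ _ (hl 1) (hl 1),
      polarL_mul h _ _ _ _ (hl 2) (hl 2), hlam]
    constructor
    · linear_combination this.1
    · linear_combination this.2
  obtain ⟨l0, s0, t0⟩ := hlift E0 a0 b0
  obtain ⟨l1, s1, t1⟩ := hlift E1 a1 b1
  obtain ⟨l3, s3, t3⟩ := hlift E3 a3 b3
  obtain ⟨l4, s4, t4⟩ := hlift E4 a4 b4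
  obtain ⟨l5, s5, t5⟩ := hlift E5 a5 b5
  let q1 := l0 * l4 - l1 * l3 + β • (l0 * l5) - α • (l3 * l3) - (α * β) • (l3 * l4)
  let q2 := l0 * l5 - l1 * l4 + β • (l3 * l3) - α • (l3 * l4)
  have q1ker : aeval h q1 = 0 := by
    simp only [q1, map_add, map_sub, map_mul, map_smul, t0, t1, t3, t4, t5]
    simpa only [C_mul'] using id1
  have q2ker : aeval h q2 = 0 := by
    simp only [q2, map_add, map_sub, map_mul, map_smul, t0, t1, t3, t4, t5]
    simpa only [C_mul'] using id2
  have q1hom : q1 ∈ homogeneousSubmodule (Fin d) K 2 :=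
    sub_mem (sub_mem (add_mem (sub_mem (s0.mul s4) (s1.mul s3)) (Submodule.smul_mem _ _ (s0.mul s5)))
      (Submodule.smul_mem _ _ (s3.mul s3))) (Submodule.smul_mem _ _ (s3.mul s4))
  have q2hom : q2 ∈ homogeneousSubmodule (Fin d) K 2 :=
    sub_mem (add_mem (sub_mem (s0.mul s5) (s1.mul s4)) (Submodule.smul_mem _ _ (s3.mul s3)))
      (Submodule.smul_mem _ _ (s3.mul s4))
  have v13 : c3 q1 = -1 := by
    simp only [c3, q1, map_add, map_sub, map_smul, polarL_mul, s0, s1, s3, s4, s5, t0, t1, t3, t4, t5, hlam,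
      r0, r1, r3, r4, r5]
    simp [Polynomial.coeff_X, Polynomial.coeff_X_pow, Polynomial.coeff_one]
  have v14 : c4 q1 = 0 := by
    simp only [c4, q1, map_add, map_sub, map_smul, polarL_mul, s0, s1, s3, s4, s5, t0, t1, t3, t4, t5, hlam,
      r0, r1, r3, r4, r5]
    simp [Polynomial.coeff_X, Polynomial.coeff_X_pow, Polynomial.coeff_one]
  have v23 : c3 q2 = 0 := by
    simp only [c3, q2, map_add, map_sub, map_smul, polarL_mul, s0, s1, s3, s4, s5, t0, t1, t3, t4, t5, hlam,
      r0, r1, r3, r4, r5]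
    simp [Polynomial.coeff_X, Polynomial.coeff_X_pow, Polynomial.coeff_one]
  have v24 : c4 q2 = -1 := by
    simp only [c4, q2, map_add, map_sub, map_smul, polarL_mul, s0, s1, s3, s4, s5, t0, t1, t3, t4, t5, hlam,
      r0, r1, r3, r4, r5]
    simp [Polynomial.coeff_X, Polynomial.coeff_X_pow, Polynomial.coeff_one]
  constructor
  · set I2 : Submodule K (MvPolynomial (Fin d) K) :=
      (RingHom.ker (aeval h : MvPolynomial (Fin d) K →ₐ[K] MvPolynomial (Fin 2) K)).restrictScalars K
            ⊓ homogeneousSubmodule (Fin d) K 2 with hI2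
    have hfin0 : Module.Finite K (homogeneousSubmodule (Fin d) K 2) :=
      Module.Finite.iff_fg.mpr (homogeneousSubmodule_fg _ _ 2)
    have hfin : Module.Finite K I2 := Submodule.finiteDimensional_of_le (inf_le_right)
    let Φ : I2 →ₗ[K] (K × K) := (c3.prod c4).comp I2.subtype
    have hsurj : Function.Surjective Φ := by
      rintro ⟨x, y⟩
      refine ⟨(-x) • ⟨q1, ⟨q1ker, q1hom⟩⟩ + (-y) • ⟨q2, ⟨q2ker, q2hom⟩⟩, ?_⟩
      rw [map_add, map_smul, map_smul]
      change (-x) • (c3 q1, c4 q1) + (-y) • (c3 q2, c4 q2) = (x, y)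
      rw [v13, v14, v23, v24]
      simp
    have hrk := LinearMap.finrank_range_add_finrank_ker Φ
    rw [LinearMap.range_eq_top.mpr hsurj, finrank_top, Module.finrank_prod, Module.finrank_self] at hrk
    have hle : Submodule.span K {q : MvPolynomial (Fin d) K |
        q ∈ RingHom.ker (aeval h : MvPolynomial (Fin d) K →ₐ[K] MvPolynomial (Fin 2) K)
        ∧ q.IsHomogeneous 2 ∧ rankLE 3 q} ≤ (LinearMap.ker Φ).map I2.subtype := by
      rw [Submodule.span_le]
      rintro q ⟨k1, k2, k3⟩
      refine ⟨⟨q, ⟨k1, k2⟩⟩, ?_, rfl⟩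
      have := hkill q k1 k3
      change (c3 q, c4 q) = (0, 0)
      rw [this.1, this.2]
    have h1 := Submodule.finrank_mono hle
    have h2 : Module.finrank K ((LinearMap.ker Φ).map I2.subtype) = Module.finrank K (LinearMap.ker Φ) :=
      Submodule.finrank_map_subtype_eq I2 (LinearMap.ker Φ)
    omega
  · rintro ⟨S, hS, hSI⟩
    have hSker : ∀ q ∈ S, aeval h q = 0 := by
      intro q hq
      have h1 : q ∈ Ideal.span S := Ideal.subset_span hq
      rw [hSI] at h1
      have h2 : Ideal.span {q : MvPolynomial (Fin d) K |
          q ∈ RingHom.ker (aeval h : MvPolynomial (Fin d) K →ₐ[K] MvPolynomial (Fin 2) K)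
          ∧ q.IsHomogeneous 2} ≤ RingHom.ker (aeval h : MvPolynomial (Fin d) K →ₐ[K] MvPolynomial (Fin 2) K) :=
        Ideal.span_le.mpr fun x hx => hx.1
      exact h2 h1
    have hq1 : q1 ∈ Ideal.span S := by
      rw [hSI]; exact Ideal.subset_span ⟨q1ker, q1hom⟩
    have h3 := comp_two S (fun q hq => (hS q hq).1) q1 hq1
    rw [homogeneousComponent_eq_self q1hom] at h3
    have h4 : Submodule.span K S ≤ LinearMap.ker c3 :=
      Submodule.span_le.mpr fun q hq => (hkill q (hSker q hq) (hS q hq).2).1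
    have h5 : c3 q1 = 0 := h4 h3
    rw [v13] at h5
    simp at h5
end

section
/- Let d ≥ 5 and let f ∈ K[s,t] be a nonzero homogeneous polynomial of degree d such that no nonzero homogeneous polynomial of degree 2 annihilates f, and such that (ℓ₁²ℓ₂)∘f = 0 for some linearly independent linear forms ℓ₁, ℓ₂ ∈ K[s,t] (i.e., the trisecant line L meets the projected curve π_p(C_d) in a double point and a simple point). Then for every K-basis h₁,…,h_d of W_f, the K-linear span of the homogeneous quadratic polynomials of rank at most 3 contained in (ker φ_h)₂ is a proper subspace of (ker φ_h)₂. In particular, the scheme X = π_p(C_d) ∪ L cut out by the quadrics through π_p(C_d) does not satisfy property QR(3). -/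
open MvPolynomial

/-- Linear version of the apolarity action. -/
noncomputable def apolarL {K : Type*} [Field K] (f : MvPolynomial (Fin 2) K) :
    MvPolynomial (Fin 2) K →ₗ[K] MvPolynomial (Fin 2) K :=
  (basisMonomials (Fin 2) K).constr K
    (fun a => (⇑(pderiv (0 : Fin 2)))^[a 0] ((⇑(pderiv (1 : Fin 2)))^[a 1] f))

lemma apolarL_monomial {K : Type*} [Field K] (f : MvPolynomial (Fin 2) K) (a : Fin 2 →₀ ℕ) :
    apolarL f (monomial a 1)
      = (⇑(pderiv (0 : Fin 2)))^[a 0] ((⇑(pderiv (1 : Fin 2)))^[a 1] f) := by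
  have := (basisMonomials (Fin 2) K).constr_basis K
    (fun a => (⇑(pderiv (0 : Fin 2)))^[a 0] ((⇑(pderiv (1 : Fin 2)))^[a 1] f)) a
  simpa [apolarL] using this

lemma apolar_eq {K : Type*} [Field K] (G f : MvPolynomial (Fin 2) K) :
    apolar G f = apolarL f G := by
  conv_rhs => rw [as_sum G]
  rw [map_sum, apolar]
  refine Finset.sum_congr rfl fun a _ => ?_
  rw [← apolarL_monomial, ← map_smul, smul_monomial, smul_eq_mul, mul_one]

lemma pderiv_comm' {K : Type*} [Field K] (f : MvPolynomial (Fin 2) K) :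
    pderiv (0 : Fin 2) (pderiv (1 : Fin 2) f) = pderiv (1 : Fin 2) (pderiv (0 : Fin 2) f) := by
  ext m
  simp only [coeff_pderiv]
  rw [add_right_comm]
  simp
  ring

/-- The iterated derivative as a product of endomorphisms. -/
noncomputable def pd {K : Type*} [Field K] (i : Fin 2) :
    Module.End K (MvPolynomial (Fin 2) K) := (pderiv i).toLinearMap

lemma pd_commute {K : Type*} [Field K] : Commute (pd (K := K) 0) (pd 1) := by
  apply LinearMap.ext
  intro f
  exact pderiv_comm' f

lemma apolarL_monomial' {K : Type*} [Field K] (f : MvPolynomial (Fin 2) K) (a : Fin 2 →₀ ℕ) :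
    apolarL f (monomial a 1) = (pd (K := K) 0 ^ a 0 * pd (K := K) 1 ^ a 1 :
      Module.End K (MvPolynomial (Fin 2) K)) f := by
  rw [apolarL_monomial, Module.End.mul_apply, Module.End.pow_apply, Module.End.pow_apply]
  rfl

lemma pd_mul {K : Type*} [Field K] (a b : Fin 2 →₀ ℕ) :
    pd (K := K) 0 ^ (a + b) 0 * pd 1 ^ (a + b) 1
      = (pd 0 ^ a 0 * pd 1 ^ a 1) * (pd 0 ^ b 0 * pd 1 ^ b 1) := by
  have h := (pd_commute (K := K)).pow_pow (b 0) (a 1)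
  simp only [Finsupp.add_apply, pow_add]
  rw [mul_assoc, mul_assoc, ← mul_assoc (pd 1 ^ a 1), ← h.eq, mul_assoc]

lemma apolarL_mul {K : Type*} [Field K] (G H f : MvPolynomial (Fin 2) K) :
    apolarL f (G * H) = apolarL (apolarL f H) G := by
  -- reduce to monomials
  have key : ∀ b : Fin 2 →₀ ℕ, ∀ G : MvPolynomial (Fin 2) K,
      apolarL f (G * monomial b 1) = apolarL (apolarL f (monomial b 1)) G := by
    intro b G
    conv_lhs => rw [as_sum G]
    conv_rhs => rw [as_sum G]
    rw [Finset.sum_mul, map_sum, map_sum]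
    refine Finset.sum_congr rfl fun a _ => ?_
    have e : (monomial a (coeff a G)) = coeff a G • (monomial a (1 : K)) := by
      rw [smul_monomial, smul_eq_mul, mul_one]
    rw [e, smul_mul_assoc, map_smul, map_smul, monomial_mul, mul_one, apolarL_monomial',
      apolarL_monomial' f b, apolarL_monomial', pd_mul]
    rfl
  have lin : ∀ (c : K) (u v : MvPolynomial (Fin 2) K), apolarL (c • u + v) G
      = c • apolarL u G + apolarL v G := by
    intro c u v
    conv_lhs => rw [as_sum G]
    conv_rhs => rw [as_sum G]
    simp only [map_sum]
    rw [Finset.smul_sum, ← Finset.sum_add_distrib]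
    refine Finset.sum_congr rfl fun a _ => ?_
    have e : (monomial a (coeff a G)) = coeff a G • (monomial a (1 : K)) := by
      rw [smul_monomial, smul_eq_mul, mul_one]
    rw [e, map_smul, map_smul, map_smul, apolarL_monomial', apolarL_monomial', apolarL_monomial',
      map_add, map_smul, smul_add, smul_comm]
  induction H using MvPolynomial.monomial_add_induction_on with
  | C a =>
    have e : (C a : MvPolynomial (Fin 2) K) = a • monomial 0 1 + 0 := by
      rw [smul_monomial]; simp
    rw [e, add_zero, mul_smul_comm, map_smul, key, map_smul]
    have := lin a (apolarL f (monomial 0 1)) 0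
    have h0 : apolarL 0 G = 0 := by
      have := lin 1 0 0
      simpa using this
    simpa [h0] using this.symm
  | monomial_add a c H _ _ ih =>
    have e : monomial a c = c • (monomial a (1 : K)) := by
      rw [smul_monomial, smul_eq_mul, mul_one]
    rw [mul_add, map_add, ih, map_add, e, mul_smul_comm, map_smul, key, map_smul, lin]

lemma apolarL_zero {K : Type*} [Field K] (G : MvPolynomial (Fin 2) K) : apolarL 0 G = 0 := by
  have := apolarL_mul G 0 (0 : MvPolynomial (Fin 2) K)
  simpa using this.symm

lemma apolarL_X {K : Type*} [Field K] (f : MvPolynomial (Fin 2) K) (i : Fin 2) :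
    apolarL f (X i) = pderiv i f := by
  rw [X, apolarL_monomial]
  fin_cases i <;> simp

lemma apolarL_one {K : Type*} [Field K] (f : MvPolynomial (Fin 2) K) :
    apolarL f 1 = f := by
  have := apolarL_monomial f 0
  simpa using this

lemma apolarL_homog {K : Type*} [Field K] (e : ℕ) : ∀ (G : MvPolynomial (Fin 2) K),
    G.IsHomogeneous e → ∀ (n : ℕ) (f : MvPolynomial (Fin 2) K), f.IsHomogeneous n →
    (apolarL f G).IsHomogeneous (n - e) := by
  induction e with
  | zero =>
    intro G hG n f hf
    rw [← totalDegree_zero_iff_isHomogeneous, totalDegree_eq_zero_iff_eq_C] at hG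
    rw [hG, C_eq_smul_one, map_smul, apolarL_one, smul_eq_C_mul]
    simpa using hf.C_mul _
  | succ e ih =>
    intro G hG n f hf
    rw [← mem_homogeneousSubmodule, ← homogeneousSubmodule_one_pow, pow_succ,
      homogeneousSubmodule_one_pow] at hG
    have : homogeneousSubmodule (Fin 2) K e * homogeneousSubmodule (Fin 2) K 1 ≤
        (homogeneousSubmodule (Fin 2) K (n - (e + 1))).comap (apolarL f) := by
      rw [Submodule.mul_le]
      intro u hu v hv
      rw [Submodule.mem_comap, apolarL_mul, mem_homogeneousSubmodule]
      have := ih u hu (n - 1) (apolarL f v) ?_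
      · rwa [Nat.sub_sub, add_comm 1 e] at this
      · rw [homogeneousSubmodule_one_eq_span_X] at hv
        rw [← mem_homogeneousSubmodule, ← Submodule.mem_comap]
        revert hv v
        change Submodule.span K _ ≤ _
        rw [Submodule.span_le]
        rintro _ ⟨i, rfl⟩
        simp only [SetLike.mem_coe, Submodule.mem_comap, apolarL_X]
        exact hf.pderiv
    exact this hG

lemma apolarL_nondeg {K : Type*} [Field K] [CharZero K] (e : ℕ) :
    ∀ (g : MvPolynomial (Fin 2) K), g.IsHomogeneous e →
    (∀ G : MvPolynomial (Fin 2) K, G.IsHomogeneous e → apolarL g G = 0) → g = 0 := by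
  induction e with
  | zero =>
    intro g _ h
    rw [← apolarL_one g]
    exact h 1 (isHomogeneous_one _ _)
  | succ e ih =>
    intro g hg h
    have h1 : ∀ i, pderiv i g = 0 := by
      intro i
      apply ih _ hg.pderiv
      intro G hG
      rw [← apolarL_X, ← apolarL_mul]
      exact h _ (hG.mul (isHomogeneous_X _ _))
    have := hg.sum_X_mul_pderiv
    simp only [h1, mul_zero, Finset.sum_const_zero] at this
    have h2 := this.symm
    rw [← Nat.cast_smul_eq_nsmul K, smul_eq_zero] at h2
    rcases h2 with h2 | h2
    · exact absurd h2 (by exact_mod_cast Nat.succ_ne_zero e)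
    · exact h2

lemma exists_theta {K : Type*} [Field K] (l₁ l₂ : MvPolynomial (Fin 2) K)
    (h1 : l₁.IsHomogeneous 1) (h2 : l₂.IsHomogeneous 1) (hli : LinearIndependent K ![l₁, l₂]) :
    (∃ θ : MvPolynomial (Fin 2) K →ₐ[K] Polynomial K, θ l₁ = Polynomial.X ∧ θ l₂ = 1) ∧
      homogeneousSubmodule (Fin 2) K 1 ≤ Submodule.span K {l₁, l₂} := by
  rw [← mem_homogeneousSubmodule, homogeneousSubmodule_one_eq_span_X,
    Submodule.mem_span_range_iff_exists_fun] at h1 h2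
  obtain ⟨c, hc⟩ := h1
  obtain ⟨e, he⟩ := h2
  rw [LinearIndependent.pair_iff] at hli
  rw [Fin.sum_univ_two] at hc he
  simp only [smul_eq_C_mul] at hc he hli
  have e0 : C (e 1) * l₁ + C (-c 1) * l₂ = C (c 0 * e 1 - c 1 * e 0) * X 0 := by
    rw [← hc, ← he]; simp only [map_sub, map_mul, map_neg]; ring
  have e1 : C (-e 0) * l₁ + C (c 0) * l₂ = C (c 0 * e 1 - c 1 * e 0) * X 1 := by
    rw [← hc, ← he]; simp only [map_sub, map_mul, map_neg]; ring
  have hD : c 0 * e 1 - c 1 * e 0 ≠ 0 := by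
    intro hD
    rw [hD, map_zero, zero_mul] at e0 e1
    have a0 := hli _ _ e0
    have a1 := hli _ _ e1
    have : l₁ = 0 := by
      rw [← hc, a1.2, neg_eq_zero.mp a0.2]; simp
    have := hli 1 0 (by simp [this])
    simp at this
  set D := c 0 * e 1 - c 1 * e 0 with hDdef
  have hCD : (C D⁻¹ * C D : MvPolynomial (Fin 2) K) = 1 := by
    rw [← C_mul, inv_mul_cancel₀ hD, C_1]
  have hPD : (Polynomial.C D⁻¹ * Polynomial.C D : Polynomial K) = 1 := by
    rw [← Polynomial.C_mul, inv_mul_cancel₀ hD, Polynomial.C_1]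
  have hPDd : (Polynomial.C D : Polynomial K) = Polynomial.C (c 0) * Polynomial.C (e 1)
      - Polynomial.C (c 1) * Polynomial.C (e 0) := by
    rw [hDdef]; simp
  refine ⟨⟨aeval ![Polynomial.C D⁻¹ * (Polynomial.C (e 1) * Polynomial.X - Polynomial.C (c 1)),
    Polynomial.C D⁻¹ * (Polynomial.C (c 0) - Polynomial.C (e 0) * Polynomial.X)], ?_, ?_⟩, ?_⟩
  · rw [← hc]
    simp only [map_add, map_mul, aeval_X, algHom_C, Matrix.cons_val_zero, Matrix.cons_val_one,
      Polynomial.algebraMap_eq]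
    linear_combination Polynomial.X * hPD - Polynomial.X * Polynomial.C D⁻¹ * hPDd
  · rw [← he]
    simp only [map_add, map_mul, aeval_X, algHom_C, Matrix.cons_val_zero, Matrix.cons_val_one,
      Polynomial.algebraMap_eq]
    linear_combination hPD - Polynomial.C D⁻¹ * hPDd
  · rw [homogeneousSubmodule_one_eq_span_X, Submodule.span_le]
    rintro _ ⟨i, rfl⟩
    rw [SetLike.mem_coe, Submodule.mem_span_pair]
    fin_cases i
    · refine ⟨D⁻¹ * e 1, D⁻¹ * (-c 1), ?_⟩
      simp only [smul_eq_C_mul, C_mul, Fin.zero_eta]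
      linear_combination C D⁻¹ * e0 + X 0 * hCD
    · refine ⟨D⁻¹ * (-e 0), D⁻¹ * (c 0), ?_⟩
      simp only [smul_eq_C_mul, C_mul, Fin.mk_one]
      linear_combination C D⁻¹ * e1 + X 1 * hCD

lemma homog_le_span {K : Type*} [Field K] (l₁ l₂ : MvPolynomial (Fin 2) K)
    (h1 : homogeneousSubmodule (Fin 2) K 1 ≤ Submodule.span K {l₁, l₂}) (e : ℕ) :
    homogeneousSubmodule (Fin 2) K e ≤
      Submodule.span K {p | ∃ i j, i + j = e ∧ p = l₁ ^ i * l₂ ^ j} := by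
  induction e with
  | zero =>
    intro G hG
    rw [mem_homogeneousSubmodule, ← totalDegree_zero_iff_isHomogeneous,
      totalDegree_eq_zero_iff_eq_C] at hG
    rw [hG, C_eq_smul_one]
    apply Submodule.smul_mem
    apply Submodule.subset_span
    exact ⟨0, 0, rfl, by simp⟩
  | succ e ih =>
    rw [← homogeneousSubmodule_one_pow, pow_succ, homogeneousSubmodule_one_pow]
    refine (mul_le_mul' ih h1).trans ?_
    rw [Submodule.span_mul_span, Submodule.span_le]
    rintro _ ⟨_, ⟨i, j, hij, rfl⟩, y, hy, rfl⟩
    apply Submodule.subset_span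
    rcases hy with rfl | rfl
    · exact ⟨i + 1, j, by omega, by simp only []; ring⟩
    · exact ⟨i, j + 1, by omega, by simp only []; ring⟩

lemma rank_core {K : Type*} [Field K] [CharZero K] (d : ℕ) (A B E : K) (hB : B ≠ 0)
    (u : Fin 3 → Polynomial K) (hdeg : ∀ i, (u i).natDegree ≤ d)
    (hrel : ∀ i, A * (u i).coeff d + B * (u i).coeff 1 + E * (u i).coeff 0 = 0)
    (hsum : ∑ i, u i ^ 2 = 0) :
    ∑ i, (u i).coeff 1 * (u i).coeff 2 = 0 := by
  have c0 := congrArg (fun p => Polynomial.coeff p 0) hsum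
  have c1 := congrArg (fun p => Polynomial.coeff p 1) hsum
  have c2 := congrArg (fun p => Polynomial.coeff p 2) hsum
  have c3 := congrArg (fun p => Polynomial.coeff p 3) hsum
  have cd := congrArg (fun p => Polynomial.coeff p (2 * d)) hsum
  simp only [Polynomial.finsetSum_coeff, Polynomial.coeff_zero] at c0 c1 c2 c3 cd
  simp only [Polynomial.coeff_pow_of_natDegree_le (hdeg _)] at cd
  simp only [pow_two, Polynomial.coeff_mul, Finset.Nat.antidiagonal_succ,
    Finset.Nat.antidiagonal_zero, Finset.sum_cons, Finset.map_singleton,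
    Finset.sum_singleton, Finset.map_cons, Function.Embedding.prodMap,
    Function.Embedding.coeFn_mk, Prod.map, Function.Embedding.refl_apply, Nat.succ_eq_add_one,
    Nat.reduceAdd, zero_add, Fin.sum_univ_three] at c0 c1 c2 c3 cd
  have m01 : ∑ i, (u i).coeff 0 * (u i).coeff 1 = 0 := by
    rw [Fin.sum_univ_three]
    have h2 : (2 : K) ≠ 0 := two_ne_zero
    apply mul_left_cancel₀ h2
    linear_combination c1
  have m00 : ∑ i, (u i).coeff 0 * (u i).coeff 0 = 0 := by
    rw [Fin.sum_univ_three]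
    linear_combination c0
  have m11 : ∑ i, (u i).coeff 1 * (u i).coeff 1 = 0 := by
    apply mul_left_cancel₀ (pow_ne_zero 2 hB)
    have r : ∀ i, B * (u i).coeff 1 = - (A * (u i).coeff d + E * (u i).coeff 0) := fun i => by
      linear_combination hrel i
    have r' : ∀ i, B ^ 2 * ((u i).coeff 1 * (u i).coeff 1)
        = A ^ 2 * ((u i).coeff d * (u i).coeff d) - 2 * E * B * ((u i).coeff 0 * (u i).coeff 1)
          - E ^ 2 * ((u i).coeff 0 * (u i).coeff 0) := fun i => by
      linear_combination (B * (u i).coeff 1 - A * (u i).coeff d + E * (u i).coeff 0) * hrel i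
    rw [Finset.mul_sum, Finset.sum_congr rfl (fun i _ => r' i)]
    rw [Fin.sum_univ_three] at m00 m01 ⊢
    linear_combination A ^ 2 * cd - 2 * E * B * m01 - E ^ 2 * m00
  have m02 : ∑ i, (u i).coeff 0 * (u i).coeff 2 = 0 := by
    have h2 : (2 : K) ≠ 0 := two_ne_zero
    apply mul_left_cancel₀ h2
    rw [Fin.sum_univ_three] at m11 ⊢
    linear_combination c2 - m11
  have m03 : ∑ i, (u i).coeff 0 * (u i).coeff 3 = - ∑ i, (u i).coeff 1 * (u i).coeff 2 := by
    have h2 : (2 : K) ≠ 0 := two_ne_zero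
    apply mul_left_cancel₀ h2
    rw [Fin.sum_univ_three, Fin.sum_univ_three]
    linear_combination c3
  by_contra ha
  have hdep : ¬ LinearIndependent K (fun (j : Fin 4) (i : Fin 3) => (u i).coeff (j : ℕ)) := by
    intro hli
    have := hli.fintype_card_le_finrank
    simp at this
  rw [Fintype.not_linearIndependent_iff] at hdep
  obtain ⟨w, hw, j, hj⟩ := hdep
  have hw' : ∀ i, w 0 * (u i).coeff 0 + w 1 * (u i).coeff 1 + w 2 * (u i).coeff 2
      + w 3 * (u i).coeff 3 = 0 := by
    intro i
    have := congrFun hw i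
    simpa [Fin.sum_univ_four] using this
  simp only [Fin.sum_univ_three] at m00 m01 m02 m03 m11 ha
  have w3 : w 3 = 0 := by
    apply mul_right_cancel₀ ha
    linear_combination -(u 0).coeff 0 * hw' 0 - (u 1).coeff 0 * hw' 1 - (u 2).coeff 0 * hw' 2
      + w 0 * m00 + w 1 * m01 + w 2 * m02 + w 3 * m03
  have w2 : w 2 = 0 := by
    apply mul_right_cancel₀ ha
    rw [w3] at hw'
    linear_combination (u 0).coeff 1 * hw' 0 + (u 1).coeff 1 * hw' 1 + (u 2).coeff 1 * hw' 2
      - w 0 * m01 - w 1 * m11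
  have w1 : w 1 = 0 := by
    apply mul_right_cancel₀ ha
    rw [w3, w2] at hw'
    linear_combination (u 0).coeff 2 * hw' 0 + (u 1).coeff 2 * hw' 1 + (u 2).coeff 2 * hw' 2
      - w 0 * m02
  have w0 : w 0 = 0 := by
    apply mul_right_cancel₀ ha
    rw [w3, w2, w1] at hw'
    linear_combination -(u 0).coeff 3 * hw' 0 - (u 1).coeff 3 * hw' 1 - (u 2).coeff 3 * hw' 2
      + w 0 * m03
  fin_cases j <;> simp_all

lemma apolarL_eq_zero_of {K : Type*} [Field K] [CharZero K] (l₁ l₂ : MvPolynomial (Fin 2) K)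
    (h1 : homogeneousSubmodule (Fin 2) K 1 ≤ Submodule.span K {l₁, l₂}) (e : ℕ)
    (g : MvPolynomial (Fin 2) K) (hg : g.IsHomogeneous e)
    (h : ∀ i j, i + j = e → apolarL g (l₁ ^ i * l₂ ^ j) = 0) : g = 0 := by
  apply apolarL_nondeg e g hg
  intro G hG
  have hG' := homog_le_span l₁ l₂ h1 _ hG
  clear hG
  induction hG' using Submodule.span_induction with
  | mem x hx =>
    obtain ⟨i, j, hij, rfl⟩ := hx
    exact h i j hij
  | zero => simp
  | add x y _ _ hx hy => rw [map_add, hx, hy, add_zero]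
  | smul c x _ hx => rw [map_smul, hx, smul_zero]

/-- Polarisation functional on quadrics. -/
noncomputable def polar {K : Type*} [Field K] {d : ℕ} (P Q : Fin d → K) :
    MvPolynomial (Fin d) K →ₗ[K] K :=
  ((MvPolynomial.aeval (0 : Fin d → K)).toLinearMap ∘ₗ
    (mkDerivation K (fun i => (C (P i) : MvPolynomial (Fin d) K))).toLinearMap) ∘ₗ
    (mkDerivation K (fun i => (C (Q i) : MvPolynomial (Fin d) K))).toLinearMap

lemma mkDer_linear {K : Type*} [Field K] {d : ℕ} (η : (Fin d → K)) (Φ : MvPolynomial (Fin d) K →ₗ[K] K)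
    (hΦ : ∀ i, Φ (X i) = η i)
    (l : MvPolynomial (Fin d) K) (hl : l.IsHomogeneous 1) :
    mkDerivation K (fun i => (C (η i) : MvPolynomial (Fin d) K)) l = C (Φ l) := by
  rw [← mem_homogeneousSubmodule, homogeneousSubmodule_one_eq_span_X] at hl
  induction hl using Submodule.span_induction with
  | mem x hx =>
    obtain ⟨i, rfl⟩ := hx
    rw [mkDerivation_X, hΦ]
  | zero => simp
  | add x y _ _ hx hy => rw [map_add, map_add, hx, hy, C_add]
  | smul c x _ hx => rw [Derivation.map_smul, map_smul, hx, smul_eq_C_mul, smul_eq_mul, C_mul]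

lemma homog_one_eval_zero {K : Type*} [Field K] {d : ℕ}
    (l : MvPolynomial (Fin d) K) (hl : l.IsHomogeneous 1) :
    MvPolynomial.aeval (0 : Fin d → K) l = 0 := by
  rw [← mem_homogeneousSubmodule, homogeneousSubmodule_one_eq_span_X] at hl
  induction hl using Submodule.span_induction with
  | mem x hx =>
    obtain ⟨i, rfl⟩ := hx
    simp
  | zero => simp
  | add x y _ _ hx hy => rw [map_add, hx, hy, add_zero]
  | smul c x _ hx => rw [map_smul, hx, smul_zero]

lemma polar_mul {K : Type*} [Field K] {d : ℕ} (Φ Ψ : MvPolynomial (Fin d) K →ₗ[K] K)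
    (c l m : MvPolynomial (Fin d) K) (hl : l.IsHomogeneous 1) (hm : m.IsHomogeneous 1) :
    polar (fun i => Φ (X i)) (fun i => Ψ (X i)) (c * (l * m))
      = MvPolynomial.aeval (0 : Fin d → K) c * (Φ l * Ψ m + Φ m * Ψ l) := by
  simp only [polar, LinearMap.comp_apply, Derivation.coeFn_coe, AlgHom.toLinearMap_apply,
    Derivation.leibniz, mkDer_linear _ Φ (fun _ => rfl) _ hl, mkDer_linear _ Φ (fun _ => rfl) _ hm,
    mkDer_linear _ Ψ (fun _ => rfl) _ hl, mkDer_linear _ Ψ (fun _ => rfl) _ hm, smul_eq_mul,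
    map_add, map_mul, homog_one_eval_zero _ hl, homog_one_eval_zero _ hm, derivation_C]
  simp only [algHom_C, Algebra.algebraMap_self, RingHom.id_apply]
  ring

lemma polar_mul' {K : Type*} [Field K] {d : ℕ} (Φ Ψ : MvPolynomial (Fin d) K →ₗ[K] K)
    (l m : MvPolynomial (Fin d) K) (hl : l.IsHomogeneous 1) (hm : m.IsHomogeneous 1) :
    polar (fun i => Φ (X i)) (fun i => Ψ (X i)) (l * m) = (Φ l * Ψ m + Φ m * Ψ l) := by
  have := polar_mul Φ Ψ 1 l m hl hm
  simpa using this

/-- The heart of the matter: a linear functional vanishing on everything of rank at most three,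
and a quadric on which it does not vanish. -/
lemma exists_functional {K : Type*} [Field K] [CharZero K]
    (d : ℕ) (hd : 5 ≤ d) (f : MvPolynomial (Fin 2) K) (hfd : f.IsHomogeneous d)
    (hno2 : ∀ G : MvPolynomial (Fin 2) K, G.IsHomogeneous 2 → apolar G f = 0 → G = 0)
    (l₁ l₂ : MvPolynomial (Fin 2) K) (hl₁ : l₁.IsHomogeneous 1) (hl₂ : l₂.IsHomogeneous 1)
    (hli : LinearIndependent K ![l₁, l₂]) (hap : apolar (l₁ ^ 2 * l₂) f = 0)
    (h : Fin d → MvPolynomial (Fin 2) K)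
    (hspan : (Submodule.span K (Set.range h) : Set (MvPolynomial (Fin 2) K))
      = {G | G.IsHomogeneous d ∧ apolar G f = 0}) :
    ∃ Λ : MvPolynomial (Fin d) K →ₗ[K] K,
      (∀ q c : MvPolynomial (Fin d) K, (aeval h : MvPolynomial (Fin d) K →ₐ[K] _) q = 0 →
        rankLE 3 q → Λ (c * q) = 0) ∧
      ∃ q : MvPolynomial (Fin d) K, (aeval h : MvPolynomial (Fin d) K →ₐ[K] _) q = 0 ∧
        q.IsHomogeneous 2 ∧ Λ q ≠ 0 := by
  obtain ⟨⟨θ, hθ₁, hθ₂⟩, hsp⟩ := exists_theta l₁ l₂ hl₁ hl₂ hli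
  have hl₁0 : l₁ ≠ 0 := hli.ne_zero 0
  have hl₂0 : l₂ ≠ 0 := hli.ne_zero 1
  simp only [apolar_eq] at hno2 hap hspan
  have hmon : ∀ i j, (l₁ ^ i * l₂ ^ j).IsHomogeneous (i + j) := fun i j => by
    simpa using (hl₁.pow i).mul (hl₂.pow j)
  have hzero : ∀ i j, apolarL f (l₁ ^ (i + 2) * l₂ ^ (j + 1)) = 0 := by
    intro i j
    have : l₁ ^ (i + 2) * l₂ ^ (j + 1) = (l₁ ^ i * l₂ ^ j) * (l₁ ^ 2 * l₂) := by ring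
    rw [this, apolarL_mul, hap, apolarL_zero]
  -- non-vanishing of two coefficients
  have nA : apolarL f (l₁ ^ d) ≠ 0 := by
    intro hA
    have h2 : apolarL f (l₁ ^ 2) = 0 := by
      apply apolarL_eq_zero_of l₁ l₂ hsp (d - 2) _
        (apolarL_homog 2 _ (by simpa using hl₁.pow 2) d f hfd)
      intro i j hij
      rw [← apolarL_mul]
      rcases j with _ | j
      · have : l₁ ^ i * l₂ ^ 0 * l₁ ^ 2 = l₁ ^ d := by
          rw [pow_zero, mul_one, ← pow_add]; congr 1; omega
        rw [this, hA]
      · rw [← hzero i j]; congr 1; ring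
    have := hno2 _ (by simpa using hl₁.pow 2) h2
    exact hl₁0 (by simpa using this)
  have nB : apolarL f (l₁ * l₂ ^ (d - 1)) ≠ 0 := by
    intro hB
    have h2 : apolarL f (l₁ * l₂) = 0 := by
      apply apolarL_eq_zero_of l₁ l₂ hsp (d - 2) _ (apolarL_homog 2 _ (hl₁.mul hl₂) d f hfd)
      intro i j hij
      rw [← apolarL_mul]
      rcases i with _ | i
      · have : l₁ ^ 0 * l₂ ^ j * (l₁ * l₂) = l₁ * l₂ ^ (d - 1) := by
          rw [show d - 1 = j + 1 by omega]; ring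
        rw [this, hB]
      · rw [← hzero i j]; congr 1; ring
    exact mul_ne_zero hl₁0 hl₂0 (hno2 _ (hl₁.mul hl₂) h2)
  -- scalar values
  have hconst : ∀ G : MvPolynomial (Fin 2) K, G.IsHomogeneous d →
      apolarL f G = C (coeff 0 (apolarL f G)) := by
    intro G hG
    have := apolarL_homog d G hG d f hfd
    rw [Nat.sub_self, ← totalDegree_zero_iff_isHomogeneous, totalDegree_eq_zero_iff_eq_C] at this
    exact this
  obtain ⟨A, hA⟩ : ∃ A, apolarL f (l₁ ^ d) = C A := ⟨_, hconst _ (by simpa using hl₁.pow d)⟩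
  obtain ⟨B, hB⟩ : ∃ B, apolarL f (l₁ * l₂ ^ (d - 1)) = C B :=
    ⟨_, hconst _ (by
      have := hmon 1 (d - 1)
      rwa [pow_one, show 1 + (d - 1) = d by omega] at this)⟩
  obtain ⟨E, hE⟩ : ∃ E, apolarL f (l₂ ^ d) = C E := ⟨_, hconst _ (by simpa using hl₂.pow d)⟩
  have hA0 : A ≠ 0 := by rintro rfl; simp [hA] at nA
  have hB0 : B ≠ 0 := by rintro rfl; simp [hB] at nB
  -- the relation
  have hrel : ∀ G : MvPolynomial (Fin 2) K, G.IsHomogeneous d → (θ G).natDegree ≤ d ∧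
      apolarL f G = C (A * (θ G).coeff d + B * (θ G).coeff 1 + E * (θ G).coeff 0) := by
    intro G hG
    have hG' := homog_le_span l₁ l₂ hsp _ hG
    clear hG
    induction hG' using Submodule.span_induction with
    | mem x hx =>
      obtain ⟨i, j, hij, rfl⟩ := hx
      have ht : θ (l₁ ^ i * l₂ ^ j) = Polynomial.X ^ i := by simp [hθ₁, hθ₂]
      rw [ht]
      refine ⟨by rw [Polynomial.natDegree_X_pow]; omega, ?_⟩
      rw [Polynomial.coeff_X_pow, Polynomial.coeff_X_pow, Polynomial.coeff_X_pow]
      rcases i with _ | _ | i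
      · obtain rfl : j = d := by omega
        rw [if_neg (by omega), if_neg (by omega), if_pos rfl]
        simp [hE]
      · obtain rfl : j = d - 1 := by omega
        rw [if_neg (by omega), if_pos rfl, if_neg (by omega)]
        simp [hB]
      · rcases j with _ | j
        · obtain rfl : i + 1 + 1 = d := by omega
          rw [if_pos rfl, if_neg (by omega), if_neg (by omega)]
          simp [hA]
        · rw [if_neg (by omega), if_neg (by omega), if_neg (by omega)]
          simp [hzero]
    | zero => simp
    | add x y _ _ hx hy =>
      refine ⟨by rw [map_add]; exact Polynomial.natDegree_add_le_of_degree_le hx.1 hy.1, ?_⟩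
      rw [map_add (apolarL f), map_add θ, hx.2, hy.2, ← C_add]
      simp only [Polynomial.coeff_add]
      congr 1; ring
    | smul c x _ hx =>
      refine ⟨by rw [map_smul]; exact (Polynomial.natDegree_smul_le _ _).trans hx.1, ?_⟩
      rw [map_smul, map_smul, hx.2, smul_eq_C_mul, ← C_mul]
      simp only [Polynomial.coeff_smul, smul_eq_mul]
      congr 1; ring
  -- linear forms
  have hW : ∀ l : MvPolynomial (Fin d) K, l.IsHomogeneous 1 →
      (aeval h l).IsHomogeneous d ∧ apolarL f (aeval h l) = 0 := by
    intro l hl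
    have : aeval h l ∈ (Submodule.span K (Set.range h) : Set (MvPolynomial (Fin 2) K)) := by
      rw [← mem_homogeneousSubmodule, homogeneousSubmodule_one_eq_span_X] at hl
      induction hl using Submodule.span_induction with
      | mem x hx =>
        obtain ⟨i, rfl⟩ := hx
        rw [aeval_X]
        exact Submodule.subset_span ⟨i, rfl⟩
      | zero => simp
      | add x y _ _ hx hy => rw [map_add]; exact Submodule.add_mem _ hx hy
      | smul c x _ hx => rw [map_smul]; exact Submodule.smul_mem _ _ hx
    rw [hspan] at this
    exact this
  have hlift : ∀ G : MvPolynomial (Fin 2) K, G.IsHomogeneous d → apolarL f G = 0 →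
      ∃ l : MvPolynomial (Fin d) K, l.IsHomogeneous 1 ∧ aeval h l = G := by
    intro G hG hG0
    have : G ∈ (Submodule.span K (Set.range h) : Set (MvPolynomial (Fin 2) K)) := by
      rw [hspan]; exact ⟨hG, hG0⟩
    rw [SetLike.mem_coe, Submodule.mem_span_range_iff_exists_fun] at this
    obtain ⟨c, hc⟩ := this
    refine ⟨∑ i, C (c i) * X i, IsHomogeneous.sum _ _ _ fun i _ => isHomogeneous_C_mul_X _ _, ?_⟩
    rw [← hc, map_sum]
    refine Finset.sum_congr rfl fun i _ => ?_
    rw [map_mul, aeval_X, algHom_C, smul_eq_C_mul]; rfl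
  let Φ : ℕ → MvPolynomial (Fin d) K →ₗ[K] K := fun n =>
    Polynomial.lcoeff K n ∘ₗ θ.toLinearMap ∘ₗ (aeval h : MvPolynomial (Fin d) K →ₐ[K] _).toLinearMap
  have hΦ : ∀ n l, Φ n l = (θ (aeval h l)).coeff n := fun n l => rfl
  refine ⟨polar (fun i => Φ 1 (X i)) (fun i => Φ 2 (X i)), ?_, ?_⟩
  · rintro q c hq ⟨ℓ, hℓ, rfl⟩
    rw [Finset.mul_sum, map_sum]
    have e : ∀ i, polar (fun i => Φ 1 (X i)) (fun i => Φ 2 (X i)) (c * ℓ i ^ 2)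
        = (2 * MvPolynomial.aeval (0 : Fin d → K) c) * (Φ 1 (ℓ i) * Φ 2 (ℓ i)) := by
      intro i
      rw [pow_two, polar_mul _ _ _ _ _ (hℓ i) (hℓ i)]
      ring
    rw [Finset.sum_congr rfl fun i _ => e i, ← Finset.mul_sum]
    have := rank_core d A B E hB0 (fun i => θ (aeval h (ℓ i)))
      (fun i => (hrel _ (hW _ (hℓ i)).1).1) (fun i => by
        have h1 := (hrel _ (hW _ (hℓ i)).1).2
        rw [(hW _ (hℓ i)).2] at h1
        exact (C_eq_zero.mp h1.symm)) (by
        have h1 := congrArg θ hq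
        simpa using h1)
    simp only [hΦ]
    rw [this, mul_zero]
  · -- the special quadric
    have hmem : ∀ i j, i + 2 + (j + 1) = d → ∃ l : MvPolynomial (Fin d) K,
        l.IsHomogeneous 1 ∧ aeval h l = l₁ ^ (i + 2) * l₂ ^ (j + 1) := fun i j hij =>
      hlift _ (by rw [← hij]; exact hmon _ _) (hzero i j)
    obtain ⟨n, rfl⟩ : ∃ n, d = n + 5 := ⟨d - 5, by omega⟩
    obtain ⟨L2, hL2, eL2⟩ := hmem 0 (n + 2) (by omega)
    obtain ⟨L3, hL3, eL3⟩ := hmem 1 (n + 1) (by omega)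
    obtain ⟨L4, hL4, eL4⟩ := hmem 2 n (by omega)
    obtain ⟨LL, hLL, eLL⟩ := hmem (n + 2) 0 (by omega)
    have hs : (l₁ ^ (n + 5)).IsHomogeneous (n + 5) := by simpa using hl₁.pow (n + 5)
    have ht : (l₂ ^ (n + 5)).IsHomogeneous (n + 5) := by simpa using hl₂.pow (n + 5)
    have hst : (l₁ * l₂ ^ (n + 4)).IsHomogeneous (n + 5) := by
      have := hmon 1 (n + 4)
      rwa [pow_one, show 1 + (n + 4) = n + 5 by omega] at this
    have hB' : apolarL f (l₁ * l₂ ^ (n + 4)) = C B := hB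
    obtain ⟨L0, hL0, eL0⟩ := hlift (C A * l₂ ^ (n + 5) - C E * l₁ ^ (n + 5))
      ((ht.C_mul _).sub (hs.C_mul _)) (by
        rw [map_sub, ← smul_eq_C_mul, ← smul_eq_C_mul, map_smul, map_smul, hA, hE,
          smul_eq_C_mul, smul_eq_C_mul]; ring)
    obtain ⟨L1, hL1, eL1⟩ := hlift (C A * (l₁ * l₂ ^ (n + 4)) - C B * l₁ ^ (n + 5))
      ((hst.C_mul _).sub (hs.C_mul _)) (by
        rw [map_sub, ← smul_eq_C_mul, ← smul_eq_C_mul, map_smul, map_smul, hA, hB',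
          smul_eq_C_mul, smul_eq_C_mul]; ring)
    refine ⟨L0 * L3 - L1 * L2 + C E * (L4 * LL) - C B * (L3 * LL), ?_, ?_, ?_⟩
    · simp only [map_add, map_sub, map_mul, eL0, eL1, eL2, eL3, eL4, eLL, algHom_C,
        algebraMap_eq]
      ring
    · exact (((hL0.mul hL3).sub (hL1.mul hL2)).add ((hL4.mul hLL).C_mul _)).sub
        ((hL3.mul hLL).C_mul _)
    · have hC : ∀ a : K, θ (C a) = Polynomial.C a := fun a => by
        rw [algHom_C]; rfl
      rw [map_sub, map_add, map_sub, polar_mul' _ _ _ _ hL0 hL3, polar_mul' _ _ _ _ hL1 hL2,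
        ← smul_eq_C_mul, ← smul_eq_C_mul, map_smul, map_smul,
        polar_mul' _ _ _ _ hL4 hLL, polar_mul' _ _ _ _ hL3 hLL]
      simp only [hΦ, eL0, eL1, eL2, eL3, eL4, eLL, map_sub, map_mul, map_pow, hθ₁, hθ₂, hC,
        one_pow, mul_one, Polynomial.coeff_sub, Polynomial.coeff_C_mul, Polynomial.coeff_X_pow,
        Polynomial.coeff_X, Polynomial.coeff_C]
      simp [hA0]

theorem stmt12 {K : Type*} [Field K] [IsAlgClosed K] [CharZero K]
    (d : ℕ) (hd : 5 ≤ d) (f : MvPolynomial (Fin 2) K) (hf : f ≠ 0) (hfd : f.IsHomogeneous d)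
    (hno2 : ∀ G : MvPolynomial (Fin 2) K, G.IsHomogeneous 2 → apolar G f = 0 → G = 0)
    (hex3 : ∃ ℓ₁ ℓ₂ : MvPolynomial (Fin 2) K, ℓ₁.IsHomogeneous 1 ∧ ℓ₂.IsHomogeneous 1
      ∧ LinearIndependent K ![ℓ₁, ℓ₂] ∧ apolar (ℓ₁ ^ 2 * ℓ₂) f = 0)
    (h : Fin d → MvPolynomial (Fin 2) K) (hind : LinearIndependent K h)
    (hspan : (Submodule.span K (Set.range h) : Set (MvPolynomial (Fin 2) K))
      = {G | G.IsHomogeneous d ∧ apolar G f = 0}) :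
    Submodule.span K {q : MvPolynomial (Fin d) K |
        q ∈ RingHom.ker (aeval h : MvPolynomial (Fin d) K →ₐ[K] MvPolynomial (Fin 2) K)
        ∧ q.IsHomogeneous 2 ∧ rankLE 3 q}
      < ((RingHom.ker (aeval h : MvPolynomial (Fin d) K →ₐ[K] MvPolynomial (Fin 2) K)).restrictScalars K
          ⊓ homogeneousSubmodule (Fin d) K 2 : Submodule K (MvPolynomial (Fin d) K))
    ∧ ¬ ∃ S : Set (MvPolynomial (Fin d) K),
        (∀ q ∈ S, q.IsHomogeneous 2 ∧ rankLE 3 q) ∧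
        Ideal.span S = Ideal.span {q : MvPolynomial (Fin d) K |
          q ∈ RingHom.ker (aeval h : MvPolynomial (Fin d) K →ₐ[K] MvPolynomial (Fin 2) K)
          ∧ q.IsHomogeneous 2} := by
  obtain ⟨ℓ₁, ℓ₂, hl₁, hl₂, hli, hap⟩ := hex3
  obtain ⟨Λ, hΛ, Q, hQ, hQ2, hΛQ⟩ :=
    exists_functional d hd f hfd hno2 ℓ₁ ℓ₂ hl₁ hl₂ hli hap h hspan
  constructor
  · refine lt_of_le_of_ne ?_ ?_
    · rw [Submodule.span_le]
      rintro q ⟨hq, hq2, -⟩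
      exact ⟨hq, hq2⟩
    · intro heq
      have hmem : Q ∈ ((RingHom.ker (aeval h : MvPolynomial (Fin d) K →ₐ[K]
          MvPolynomial (Fin 2) K)).restrictScalars K
          ⊓ homogeneousSubmodule (Fin d) K 2 : Submodule K (MvPolynomial (Fin d) K)) :=
        ⟨hQ, hQ2⟩
      rw [← heq] at hmem
      apply hΛQ
      clear hQ hQ2 hΛQ
      induction hmem using Submodule.span_induction with
      | mem x hx =>
        have := hΛ x 1 hx.1 hx.2.2
        rwa [one_mul] at this
      | zero => simp
      | add x y _ _ hx hy => rw [map_add, hx, hy, add_zero]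
      | smul c x _ hx => rw [map_smul, hx, smul_zero]
  · rintro ⟨S, hS, hSI⟩
    have hle : Ideal.span S ≤ RingHom.ker (aeval h : MvPolynomial (Fin d) K →ₐ[K]
        MvPolynomial (Fin 2) K) := by
      rw [hSI, Ideal.span_le]
      intro q hq
      exact hq.1
    have hmem : Q ∈ Ideal.span S := by
      rw [hSI]
      exact Ideal.subset_span ⟨hQ, hQ2⟩
    have hall : ∀ p ∈ Ideal.span S, ∀ c, Λ (c * p) = 0 := by
      intro p hp
      induction hp using Submodule.span_induction with
      | mem x hx =>
        intro c
        exact hΛ x c (hle (Ideal.subset_span hx)) (hS x hx).2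
      | zero => simp
      | add x y _ _ hx hy => intro c; rw [mul_add, map_add, hx, hy, add_zero]
      | smul a x _ hx => intro c; rw [smul_eq_mul, ← mul_assoc, hx]
    have := hall Q hmem 1
    rw [one_mul] at this
    exact hΛQ this
end
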